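/- arXiv:1407.2300 — 4 statements merged into one kernel-verified Lean document; each statement's English description precedes it below -/
import Mathlib

section
/- Let K be a field and Λ a finite-dimensional associative unital K-algebra, and suppose P^∞(Λ-mod) is contravariantly finite in Λ-mod. For each simple left Λ-module S, let A_S be a right P^∞(Λ-mod)-approximation of S of minimal K-dimension among all right P^∞(Λ-mod)-approximations of S. Then l.findim Λ = l.Findim Λ = sup over the (finitely many) isomorphism classes of simple left Λ-modules S of the projective dimension of A_S; in particular l.Findim Λ is finite. -/
universe u

/-- `HasProjDimLE Λ n M` means the left `Λ`-module `M` has projective dimension `≤ n`: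
for `n = 0` it is projective, and for `n+1` there is a surjection from a projective module
whose kernel has projective dimension `≤ n`. -/
def HasProjDimLE (Λ : Type u) [Ring Λ] : ℕ → ModuleCat.{u} Λ → Prop
  | 0, M => Module.Projective Λ M
  | n + 1, M => ∃ (P : ModuleCat.{u} Λ) (g : P →ₗ[Λ] M),
      Module.Projective Λ P ∧ Function.Surjective g ∧
        HasProjDimLE Λ n (ModuleCat.of Λ (LinearMap.ker g))

/-- A module has finite projective dimension. -/
def HasFinProjDim (Λ : Type u) [Ring Λ] (M : ModuleCat.{u} Λ) : Prop :=
  ∃ n, HasProjDimLE Λ n M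

/-- `f : A → M` is a right `P^∞(Λ-mod)`-approximation of `M`. -/
def IsRightApprox (Λ : Type u) [Ring Λ] (M A : ModuleCat.{u} Λ) (f : A →ₗ[Λ] M) : Prop :=
  Module.Finite Λ A ∧ HasFinProjDim Λ A ∧
    ∀ (B : ModuleCat.{u} Λ), Module.Finite Λ B → HasFinProjDim Λ B →
      ∀ g : B →ₗ[Λ] M, ∃ h : B →ₗ[Λ] A, f ∘ₗ h = g

/-- `f : M → A` is a left `P^∞(Λ-mod)`-approximation of `M`. -/
def IsLeftApprox (Λ : Type u) [Ring Λ] (M A : ModuleCat.{u} Λ) (f : M →ₗ[Λ] A) : Prop :=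
  Module.Finite Λ A ∧ HasFinProjDim Λ A ∧
    ∀ (B : ModuleCat.{u} Λ), Module.Finite Λ B → HasFinProjDim Λ B →
      ∀ g : M →ₗ[Λ] B, ∃ h : A →ₗ[Λ] B, h ∘ₗ f = g

/-- `P^∞(Λ-mod)` is contravariantly finite in `Λ-mod`. -/
def ContravariantlyFinite (Λ : Type u) [Ring Λ] : Prop :=
  ∀ M : ModuleCat.{u} Λ, Module.Finite Λ M →
    ∃ (A : ModuleCat.{u} Λ) (f : A →ₗ[Λ] M), IsRightApprox Λ M A f

/-- `P^∞(Λ-mod)` is covariantly finite in `Λ-mod`. -/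
def CovariantlyFinite (Λ : Type u) [Ring Λ] : Prop :=
  ∀ M : ModuleCat.{u} Λ, Module.Finite Λ M →
    ∃ (A : ModuleCat.{u} Λ) (f : M →ₗ[Λ] A), IsLeftApprox Λ M A f

/-- The projective dimension of a module, as an element of `ℕ∞` (`⊤` if infinite). -/
noncomputable def projDim (Λ : Type u) [Ring Λ] (M : ModuleCat.{u} Λ) : ℕ∞ :=
  sInf {d : ℕ∞ | ∃ n : ℕ, d = n ∧ HasProjDimLE Λ n M}

/-- The little finitistic dimension `l.findim Λ`. -/
noncomputable def finDimLittle (Λ : Type u) [Ring Λ] : ℕ∞ :=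
  ⨆ (M : ModuleCat.{u} Λ) (_ : Module.Finite Λ M ∧ HasFinProjDim Λ M), projDim Λ M

/-- The big finitistic dimension `l.Findim Λ`. -/
noncomputable def finDimBig (Λ : Type u) [Ring Λ] : ℕ∞ :=
  ⨆ (M : ModuleCat.{u} Λ) (_ : HasFinProjDim Λ M), projDim Λ M

/-- `M` is a direct limit of a directed system of finitely generated modules of finite
projective dimension. -/
def IsDirectLimitOfFGFinProjDim (Λ : Type u) [Ring Λ] (M : ModuleCat.{u} Λ) : Prop :=
  ∃ (ι : Type u) (_ : Preorder ι) (_ : DecidableEq ι), Nonempty ι ∧ IsDirected ι (· ≤ ·) ∧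
    ∃ (G : ι → ModuleCat.{u} Λ) (f : ∀ i j : ι, i ≤ j → G i →ₗ[Λ] G j),
      DirectedSystem (fun i => G i) (fun i j h => f i j h) ∧
      (∀ i, Module.Finite Λ (G i) ∧ HasFinProjDim Λ (G i)) ∧
      Nonempty ((Module.DirectLimit (fun i => G i) f) ≃ₗ[Λ] M)

/-- A finite-dimensional associative unital algebra over `K`, bundled. -/
structure FDAlg (K : Type u) [Field K] : Type (u + 1) where
  carrier : Type u
  [ringInst : Ring carrier]
  [algInst : Algebra K carrier]
  [fdInst : FiniteDimensional K carrier]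

attribute [instance] FDAlg.ringInst FDAlg.algInst FDAlg.fdInst

namespace FinitisticDimension

open CategoryTheory Abelian

/-- `0 → A → B → C → 0` is a short exact sequence of modules. -/
structure IsSES {Λ : Type u} [Ring Λ] {A B C : ModuleCat.{u} Λ} (i : A →ₗ[Λ] B) (p : B →ₗ[Λ] C) :
    Prop where
  inj : Function.Injective i
  exact : Function.Exact i p
  surj : Function.Surjective p

section Homological

variable {Λ : Type u} [Ring Λ] {A B C : ModuleCat.{u} Λ} {i : A →ₗ[Λ] B} {p : B →ₗ[Λ] C}

lemma IsSES.comp_eq_zero (h : IsSES i p) : p ∘ₗ i = 0 :=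
  h.exact.linearMap_comp_eq_zero

lemma IsSES.apply_apply_eq_zero (h : IsSES i p) (a : A) : p (i a) = 0 :=
  h.exact.apply_apply_eq_zero a

lemma isSES_ker (h : Function.Surjective p) :
    IsSES (A := ModuleCat.of Λ (LinearMap.ker p)) (LinearMap.ker p).subtype p :=
  ⟨Subtype.val_injective, LinearMap.exact_subtype_ker_map p, h⟩

lemma isSES_quotient (h : Function.Injective i) :
    IsSES (C := ModuleCat.of Λ (B ⧸ LinearMap.range i)) i (LinearMap.range i).mkQ :=
  ⟨h, LinearMap.exact_map_mkQ_range i, Submodule.mkQ_surjective _⟩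

/-- The short complex in `ModuleCat Λ` attached to a short exact sequence. -/
def IsSES.shortComplex (h : IsSES i p) : ShortComplex (ModuleCat.{u} Λ) :=
  ShortComplex.mk (ModuleCat.ofHom i) (ModuleCat.ofHom p)
    (by rw [← ModuleCat.ofHom_comp, h.comp_eq_zero]; rfl)

lemma IsSES.shortExact (h : IsSES i p) : h.shortComplex.ShortExact where
  exact := (ShortComplex.ShortExact.moduleCat_exact_iff_function_exact _).2 h.exact
  mono_f := (ModuleCat.mono_iff_injective _).2 h.inj
  epi_g := (ModuleCat.epi_iff_surjective _).2 h.surj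

/-- `Ext` groups vanish in degree `n`. -/
def ExtVanish (n : ℕ) (X Y : ModuleCat.{u} Λ) : Prop := Subsingleton (Ext X Y n)

lemma IsSES.extend (h : IsSES i p) {Y : ModuleCat.{u} Λ} (hY : ExtVanish 1 C Y)
    (φ : A →ₗ[Λ] Y) : ∃ ψ : B →ₗ[Λ] Y, ψ ∘ₗ i = φ := by
  let φ' : h.shortComplex.X₁ ⟶ Y := ModuleCat.ofHom φ
  obtain ⟨x, hx⟩ := Ext.contravariant_sequence_exact₁ h.shortExact Y (Ext.mk₀ φ')
    (add_zero 1) (hY.elim _ _)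
  obtain ⟨ψ, rfl⟩ := Ext.homEquiv₀.symm.surjective x
  refine ⟨ψ.hom, ?_⟩
  have h2 : h.shortComplex.f ≫ ψ = φ' := by
    refine Ext.homEquiv₀.symm.injective ?_
    rw [Ext.homEquiv₀_symm_apply, Ext.homEquiv₀_symm_apply, ← hx, Ext.homEquiv₀_symm_apply,
      Ext.mk₀_comp_mk₀]
  exact congrArg ModuleCat.Hom.hom h2

lemma IsSES.extVanish_one (h : IsSES i p) {Y : ModuleCat.{u} Λ} (hB : ExtVanish 1 B Y)
    (H : ∀ φ : A →ₗ[Λ] Y, ∃ ψ : B →ₗ[Λ] Y, ψ ∘ₗ i = φ) : ExtVanish 1 C Y := by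
  refine ⟨fun a b => ?_⟩
  suffices ∀ x : Ext C Y 1, x = 0 by rw [this a, this b]
  intro x
  obtain ⟨y, hy⟩ := Ext.contravariant_sequence_exact₃ h.shortExact Y x (hB.elim _ _) (add_zero 1)
  obtain ⟨φ, rfl⟩ := Ext.homEquiv₀.symm.surjective y
  obtain ⟨ψ, hψ⟩ := H φ.hom
  let ψ' : h.shortComplex.X₂ ⟶ Y := ModuleCat.ofHom ψ
  have h2 : φ = h.shortComplex.f ≫ ψ' := ModuleCat.hom_ext hψ.symm
  rw [← hy, h2, Ext.homEquiv₀_symm_apply, ← Ext.mk₀_comp_mk₀]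
  exact ShortComplex.ShortExact.extClass_comp_assoc ..

lemma IsSES.extVanish_right (h : IsSES i p) {Y : ModuleCat.{u} Λ} {n : ℕ}
    (hA : ExtVanish n A Y) (hB : ExtVanish (n + 1) B Y) : ExtVanish (n + 1) C Y := by
  refine ⟨fun a b => ?_⟩
  suffices ∀ x : Ext C Y (n + 1), x = 0 by rw [this a, this b]
  intro x
  obtain ⟨y, hy⟩ := Ext.contravariant_sequence_exact₃ h.shortExact Y x (hB.elim _ _) (add_comm 1 n)
  rw [← hy, show y = 0 from hA.elim _ _]
  exact Ext.comp_zero ..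

lemma IsSES.extVanish_left (h : IsSES i p) {Y : ModuleCat.{u} Λ} {n : ℕ}
    (hB : ExtVanish n B Y) (hC : ExtVanish (n + 1) C Y) : ExtVanish n A Y := by
  refine ⟨fun a b => ?_⟩
  suffices ∀ x : Ext A Y n, x = 0 by rw [this a, this b]
  intro x
  obtain ⟨y, hy⟩ := Ext.contravariant_sequence_exact₁ h.shortExact Y x (add_comm 1 n) (hC.elim _ _)
  rw [← hy, show y = 0 from hB.elim _ _]
  exact Ext.comp_zero ..

lemma IsSES.extVanish_right_of_covariant (h : IsSES i p) {X : ModuleCat.{u} Λ} {n : ℕ}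
    (hB : ExtVanish n X B) (hA : ExtVanish (n + 1) X A) : ExtVanish n X C := by
  refine ⟨fun a b => ?_⟩
  suffices ∀ x : Ext X C n, x = 0 by rw [this a, this b]
  intro x
  obtain ⟨y, hy⟩ := Ext.covariant_sequence_exact₃ X h.shortExact x rfl (hA.elim _ _)
  rw [← hy, show y = 0 from hB.elim _ _]
  exact Ext.zero_comp ..

lemma ExtVanish.of_retract {X X' Y : ModuleCat.{u} Λ} {n : ℕ} (h : ExtVanish n X Y)
    {s : X' →ₗ[Λ] X} {r : X →ₗ[Λ] X'} (hrs : r ∘ₗ s = LinearMap.id) : ExtVanish n X' Y := by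
  refine ⟨fun a b => ?_⟩
  suffices ∀ x : Ext X' Y n, x = 0 by rw [this a, this b]
  intro x
  have h1 : ModuleCat.ofHom s ≫ ModuleCat.ofHom r = 𝟙 X' := by
    rw [← ModuleCat.ofHom_comp, hrs]; rfl
  rw [← x.mk₀_id_comp, ← h1, ← Ext.mk₀_comp_mk₀, Ext.comp_assoc_of_second_deg_zero,
    show (Ext.mk₀ (ModuleCat.ofHom r)).comp x (zero_add n) = 0 from h.elim _ _, Ext.comp_zero]

lemma extVanish_of_projective {X : ModuleCat.{u} Λ} [Module.Projective Λ X]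
    (Y : ModuleCat.{u} Λ) (n : ℕ) : ExtVanish (n + 1) X Y := by
  have : Projective X := (IsProjective.iff_projective X).1 inferInstance
  exact HasProjectiveDimensionLT.subsingleton X 1 (n + 1) (by lia) Y

lemma hasProjDimLE_iff {n : ℕ} {M : ModuleCat.{u} Λ} :
    HasProjDimLE Λ n M ↔ HasProjectiveDimensionLT M (n + 1) := by
  induction n generalizing M with
  | zero =>
    rw [zero_add, ← projective_iff_hasProjectiveDimensionLT_one, ← IsProjective.iff_projective]
    rfl
  | succ n ih =>
    constructor
    · rintro ⟨P, g, hP, hg, hk⟩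
      exact ((isSES_ker hg).shortExact.hasProjectiveDimensionLT_X₃_iff n
        ((IsProjective.iff_projective P).1 hP)).2 (ih.1 hk)
    · intro h
      have hg := Finsupp.linearCombination_id_surjective Λ M
      refine ⟨ModuleCat.of Λ (M →₀ Λ), Finsupp.linearCombination Λ _root_.id,
        inferInstance, hg, ih.2 ?_⟩
      exact
        ((isSES_ker (B := ModuleCat.of Λ (M →₀ Λ)) hg).shortExact.hasProjectiveDimensionLT_X₃_iff
          n ((IsProjective.iff_projective (ModuleCat.of Λ (M →₀ Λ))).1 inferInstance)).1 h

lemma _root_.HasProjDimLE.mono {n m : ℕ} {M : ModuleCat.{u} Λ} (h : HasProjDimLE Λ n M)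
    (hnm : n ≤ m) : HasProjDimLE Λ m M := by
  rw [hasProjDimLE_iff] at h ⊢
  exact hasProjectiveDimensionLT_of_ge M (n + 1) (m + 1) (by lia)

lemma _root_.HasProjDimLE.of_retract {n : ℕ} {M N : ModuleCat.{u} Λ} (h : HasProjDimLE Λ n M)
    {s : N →ₗ[Λ] M} {r : M →ₗ[Λ] N} (hrs : r ∘ₗ s = LinearMap.id) : HasProjDimLE Λ n N := by
  rw [hasProjDimLE_iff] at h ⊢
  exact Retract.hasProjectiveDimensionLT (Y := M)
    ⟨ModuleCat.ofHom s, ModuleCat.ofHom r, by rw [← ModuleCat.ofHom_comp, hrs]; rfl⟩ _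

lemma IsSES.hasProjDimLE_mid (h : IsSES i p) {n : ℕ} (hA : HasProjDimLE Λ n A)
    (hC : HasProjDimLE Λ n C) : HasProjDimLE Λ n B := by
  rw [hasProjDimLE_iff] at *
  exact h.shortExact.hasProjectiveDimensionLT_X₂ _ hA hC

lemma IsSES.hasProjDimLE_right (h : IsSES i p) {n : ℕ} (hA : HasProjDimLE Λ n A)
    (hB : HasProjDimLE Λ (n + 1) B) : HasProjDimLE Λ (n + 1) C := by
  rw [hasProjDimLE_iff] at *
  exact h.shortExact.hasProjectiveDimensionLT_X₃ _ hA hB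

lemma IsSES.hasProjDimLE_left (h : IsSES i p) {n : ℕ} (hB : HasProjDimLE Λ n B)
    (hC : HasProjDimLE Λ (n + 1) C) : HasProjDimLE Λ n A := by
  rw [hasProjDimLE_iff] at *
  exact h.shortExact.hasProjectiveDimensionLT_X₁ _ hB hC

lemma _root_.HasProjDimLE.extVanish {n m : ℕ} {X : ModuleCat.{u} Λ} (h : HasProjDimLE Λ n X)
    (hnm : n < m) (Y : ModuleCat.{u} Λ) : ExtVanish m X Y :=
  (hasProjDimLE_iff.1 h).subsingleton X (n + 1) m hnm Y

lemma projDim_le_iff {M : ModuleCat.{u} Λ} {d : ℕ} : projDim Λ M ≤ d ↔ HasProjDimLE Λ d M := by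
  constructor
  · intro h
    have hne : {d : ℕ∞ | ∃ n : ℕ, d = n ∧ HasProjDimLE Λ n M}.Nonempty := by
      by_contra hc
      rw [Set.not_nonempty_iff_eq_empty] at hc
      rw [projDim, hc, sInf_empty] at h
      exact ENat.natCast_ne_top d (top_le_iff.1 h)
    obtain ⟨n, hn, hM⟩ := csInf_mem hne
    refine hM.mono ?_
    rw [projDim, hn] at h
    exact_mod_cast h
  · exact fun h => sInf_le ⟨d, rfl, h⟩

end Homological

section Approximation

variable {Λ : Type u} [Ring Λ] {A B C X Y : ModuleCat.{u} Λ} {i : A →ₗ[Λ] B} {p : B →ₗ[Λ] C}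

lemma IsSES.exists_lift (h : IsSES i p) {v : X →ₗ[Λ] B} (hv : p ∘ₗ v = 0) :
    ∃ t : X →ₗ[Λ] A, i ∘ₗ t = v := by
  have hmem : ∀ x, v x ∈ LinearMap.range i := fun x => by
    obtain ⟨a, ha⟩ := (h.exact (v x)).1 (LinearMap.congr_fun hv x)
    exact ⟨a, ha⟩
  refine ⟨(LinearEquiv.ofInjective i h.inj).symm.toLinearMap ∘ₗ v.codRestrict _ hmem, ?_⟩
  ext x
  have := (LinearEquiv.ofInjective i h.inj).apply_symm_apply (v.codRestrict _ hmem x)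
  exact congrArg Subtype.val this

lemma IsSES.exists_desc (h : IsSES i p) {v : B →ₗ[Λ] Y} (hv : v ∘ₗ i = 0) :
    ∃ t : C →ₗ[Λ] Y, t ∘ₗ p = v := by
  have hker : LinearMap.ker p ≤ LinearMap.ker v := by
    intro b hb
    obtain ⟨a, rfl⟩ := (h.exact b).1 hb
    exact LinearMap.congr_fun hv a
  refine ⟨(LinearMap.ker p).liftQ v hker ∘ₗ
    (p.quotKerEquivOfSurjective h.surj).symm.toLinearMap, ?_⟩
  ext b
  have : (p.quotKerEquivOfSurjective h.surj).symm (p b) = (LinearMap.ker p).mkQ b := by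
    rw [LinearEquiv.symm_apply_eq]; rfl
  simp [this]

/-- Pushouts of modules along a monomorphism. -/
lemma IsSES.exists_pushout (h : IsSES i p) (u : A →ₗ[Λ] X) :
    ∃ (E : ModuleCat.{u} Λ) (j : X →ₗ[Λ] E) (k : B →ₗ[Λ] E) (q : E →ₗ[Λ] C),
      IsSES j q ∧ q ∘ₗ k = p ∧ k ∘ₗ i = j ∘ₗ u ∧ (∀ e, ∃ x b, e = j x + k b) ∧
      (∀ (Y : ModuleCat.{u} Λ) (f : X →ₗ[Λ] Y) (v : B →ₗ[Λ] Y), v ∘ₗ i = f ∘ₗ u →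
        ∃ l : E →ₗ[Λ] Y, l ∘ₗ j = f ∧ l ∘ₗ k = v) ∧
      (Function.Injective u → Function.Injective k) ∧
      (∀ b x, k b = j x → ∃ a, i a = b ∧ u a = x) := by
  let R : Submodule Λ (X × B) := LinearMap.range (u.prod (-i))
  let j : X →ₗ[Λ] (X × B) ⧸ R := R.mkQ ∘ₗ LinearMap.inl Λ X B
  let k : B →ₗ[Λ] (X × B) ⧸ R := R.mkQ ∘ₗ LinearMap.inr Λ X B
  have hR : R ≤ LinearMap.ker (p ∘ₗ LinearMap.snd Λ X B) := by
    rintro _ ⟨a, rfl⟩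
    simp [h.apply_apply_eq_zero]
  let q : (X × B) ⧸ R →ₗ[Λ] C := R.liftQ (p ∘ₗ LinearMap.snd Λ X B) hR
  have hki : k ∘ₗ i = j ∘ₗ u := by
    ext a
    refine (Submodule.Quotient.eq R).2 ⟨-a, ?_⟩
    simp
  have hgen : ∀ e, ∃ x b, e = j x + k b := by
    intro e
    obtain ⟨⟨x, b⟩, rfl⟩ := R.mkQ_surjective e
    refine ⟨x, b, ?_⟩
    simp only [j, k, LinearMap.comp_apply, ← map_add]
    simp
  have hqj : ∀ x, q (j x) = 0 := fun x => by simp [q, j]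
  have hqk : ∀ b, q (k b) = p b := fun b => by simp [q, k]
  have hkj : ∀ b x, k b = j x → ∃ a, i a = b ∧ u a = x := by
    intro b x hbx
    obtain ⟨a, ha⟩ := (Submodule.Quotient.eq R).1 hbx
    simp only [LinearMap.prod_apply, Function.prod_apply, LinearMap.inr_apply, LinearMap.inl_apply,
      Prod.mk_sub_mk, zero_sub, sub_zero, Prod.mk.injEq, LinearMap.neg_apply] at ha
    exact ⟨-a, by rw [map_neg]; exact ha.2, by rw [map_neg, ha.1, neg_neg]⟩
  refine ⟨ModuleCat.of Λ ((X × B) ⧸ R), j, k, q, ⟨?_, ?_, ?_⟩, LinearMap.ext hqk, hki, hgen, ?_,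
    ?_, hkj⟩
  · rw [injective_iff_map_eq_zero]
    intro x hx
    obtain ⟨a, ha, rfl⟩ := hkj 0 x (by rw [hx, map_zero])
    rw [h.inj (ha.trans (map_zero i).symm), map_zero]
  · intro e
    constructor
    · intro he
      obtain ⟨x, b, rfl⟩ := hgen e
      rw [map_add, hqj, hqk, zero_add] at he
      obtain ⟨a, rfl⟩ := (h.exact b).1 he
      refine ⟨x + u a, ?_⟩
      rw [map_add]
      exact congrArg (j x + ·) (LinearMap.congr_fun hki a).symm
    · rintro ⟨x, rfl⟩
      exact hqj x
  · intro c
    obtain ⟨b, rfl⟩ := h.surj c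
    exact ⟨k b, hqk b⟩
  · intro Y f v hv
    refine ⟨R.liftQ (f.coprod v) ?_, ?_, ?_⟩
    · rintro _ ⟨a, rfl⟩
      have := LinearMap.congr_fun hv a
      simp only [LinearMap.comp_apply] at this
      simp [this]
    · ext x; simp [j]
    · ext b; simp [k]
  · intro hu
    rw [injective_iff_map_eq_zero]
    intro b hb
    obtain ⟨a, rfl, ha⟩ := hkj b 0 (by rw [hb, map_zero])
    rw [hu (ha.trans (map_zero u).symm), map_zero]

/-- Membership in `P^∞(Λ-mod)`. -/
def FinProj (X : ModuleCat.{u} Λ) : Prop := Module.Finite Λ X ∧ HasFinProjDim Λ X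

lemma IsSES.finProj_mid (h : IsSES i p) (hA : FinProj A) (hC : FinProj C) : FinProj B := by
  obtain ⟨_, n, hn⟩ := hA
  obtain ⟨_, m, hm⟩ := hC
  exact ⟨Module.Finite.of_exact h.exact h.surj,
    max n m, h.hasProjDimLE_mid (hn.mono (le_max_left n m)) (hm.mono (le_max_right n m))⟩

lemma IsSES.finProj_right (h : IsSES i p) (hA : FinProj A) (hB : FinProj B) : FinProj C := by
  obtain ⟨_, n, hn⟩ := hA
  obtain ⟨_, m, hm⟩ := hB
  exact ⟨Module.Finite.of_surjective p h.surj, max n m + 1,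
    h.hasProjDimLE_right (hn.mono (le_max_left n m)) (hm.mono (by lia))⟩

lemma IsSES.finProj_left [IsNoetherianRing Λ] (h : IsSES i p) (hB : FinProj B) (hC : FinProj C) :
    FinProj A := by
  obtain ⟨_, n, hn⟩ := hB
  obtain ⟨_, m, hm⟩ := hC
  exact ⟨Module.Finite.of_injective i h.inj, max n m,
    h.hasProjDimLE_left (hn.mono (le_max_left n m)) (hm.mono (by lia))⟩

lemma finProj_of_projective [Module.Finite Λ X] [h : Module.Projective Λ X] : FinProj X :=
  ⟨inferInstance, 0, h⟩

lemma exists_isSES_of_finite (X : ModuleCat.{u} Λ) [Module.Finite Λ X] :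
    ∃ (K P : ModuleCat.{u} Λ) (i : K →ₗ[Λ] P) (p : P →ₗ[Λ] X), IsSES i p ∧
      Module.Finite Λ P ∧ Module.Projective Λ P := by
  obtain ⟨n, g, hg⟩ := Module.Finite.exists_fin' Λ X
  exact ⟨_, ModuleCat.of Λ (Fin n → Λ), _, g, isSES_ker hg,
    inferInstanceAs (Module.Finite Λ (Fin n → Λ)),
    inferInstanceAs (Module.Projective Λ (Fin n → Λ))⟩

/-- The right lifting property against the inclusions `K → P` where `P` is finitely generated
projective and `P / K` lies in `P^∞(Λ-mod)`. -/
def HasLifting (a : A →ₗ[Λ] X) : Prop :=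
  ∀ ⦃K P B : ModuleCat.{u} Λ⦄ (i : K →ₗ[Λ] P) (p : P →ₗ[Λ] B), IsSES i p → Module.Finite Λ P →
    Module.Projective Λ P → FinProj B → ∀ (u : K →ₗ[Λ] A) (v : P →ₗ[Λ] X), v ∘ₗ i = a ∘ₗ u →
      ∃ w : P →ₗ[Λ] A, w ∘ₗ i = u ∧ a ∘ₗ w = v

lemma HasLifting.exists_lift {a : A →ₗ[Λ] X} (ha : HasLifting a) (hB : FinProj B)
    (g : B →ₗ[Λ] X) : ∃ h : B →ₗ[Λ] A, a ∘ₗ h = g := by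
  have := hB.1
  obtain ⟨K, P, i, p, hs, hP, hP'⟩ := exists_isSES_of_finite B
  obtain ⟨w, hw, haw⟩ := ha i p hs hP hP' hB 0 (g ∘ₗ p)
    (by rw [LinearMap.comp_assoc, hs.comp_eq_zero]; simp)
  obtain ⟨t, ht⟩ := hs.exists_desc hw
  refine ⟨t, ?_⟩
  rw [← LinearMap.cancel_right hs.surj, LinearMap.comp_assoc, ht, haw]

/-- Approximations by modules of projective dimension at most `d` with a lifting property. -/
def HasSpecialApprox (d : ℕ) (X : ModuleCat.{u} Λ) : Prop :=
  ∃ (A : ModuleCat.{u} Λ) (a : A →ₗ[Λ] X), Function.Surjective a ∧ HasLifting a ∧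
    Module.Finite Λ A ∧ HasProjDimLE Λ d A

lemma HasSpecialApprox.hasProjDimLE {d : ℕ} (h : HasSpecialApprox d X) (hX : FinProj X) :
    HasProjDimLE Λ d X := by
  obtain ⟨A, a, -, ha, -, hd⟩ := h
  obtain ⟨s, hs⟩ := ha.exists_lift hX LinearMap.id
  exact hd.of_retract hs

lemma IsSES.hasSpecialApprox_mid [IsNoetherianRing Λ] (h : IsSES i p) {d : ℕ}
    (hA : HasSpecialApprox d A) (hC : HasSpecialApprox d C) : HasSpecialApprox d B := by
  obtain ⟨A', a', ha's, ha', hfA', hdA'⟩ := hA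
  obtain ⟨A'', a'', ha''s, ha'', hfA'', hdA''⟩ := hC
  obtain ⟨K, P, i₀, p₀, hs, hP, hP'⟩ := exists_isSES_of_finite A''
  obtain ⟨v₀, hv₀⟩ := Module.projective_lifting_property p (a'' ∘ₗ p₀) h.surj
  obtain ⟨t, ht⟩ := h.exists_lift (v := v₀ ∘ₗ i₀) (by
    rw [← LinearMap.comp_assoc, hv₀, LinearMap.comp_assoc, hs.comp_eq_zero, LinearMap.comp_zero])
  have hK : FinProj K := hs.finProj_left finProj_of_projective ⟨hfA'', d, hdA''⟩
  obtain ⟨u₀, hu₀⟩ := ha'.exists_lift hK t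
  obtain ⟨E, j, k, q, hE, hqk, -, hgen, hl, -, -⟩ := hs.exists_pushout u₀
  obtain ⟨l, hlj, hlk⟩ := hl B (i ∘ₗ a') v₀ (by rw [LinearMap.comp_assoc, hu₀, ht])
  have hpl : p ∘ₗ l = a'' ∘ₗ q := by
    ext e
    obtain ⟨x, b, rfl⟩ := hgen e
    have h1 := LinearMap.congr_fun hlj x
    have h2 := LinearMap.congr_fun hlk b
    have h3 := LinearMap.congr_fun hqk b
    have h4 := LinearMap.congr_fun hv₀ b
    simp only [LinearMap.comp_apply] at h1 h2 h3 h4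
    simp [h1, h2, h3, h4, h.apply_apply_eq_zero, hE.apply_apply_eq_zero]
  refine ⟨E, l, ?_, ?_, ?_, hE.hasProjDimLE_mid hdA' hdA''⟩
  · intro x
    obtain ⟨y, hy⟩ := ha''s (p x)
    obtain ⟨e, rfl⟩ := hE.surj y
    obtain ⟨x', hx'⟩ := (h.exact (x - l e)).1 (by
      rw [map_sub, ← hy]; exact sub_eq_zero.2 (LinearMap.congr_fun hpl e).symm)
    obtain ⟨y', rfl⟩ := ha's x'
    refine ⟨e + j y', ?_⟩
    rw [map_add, ← add_sub_cancel (l e) x, ← hx']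
    exact congrArg (l e + ·) (LinearMap.congr_fun hlj y')
  · intro K' P' B' i' p' hs' hP1 hP2 hB' u v huv
    obtain ⟨w'', hw'', haw''⟩ := ha'' i' p' hs' hP1 hP2 hB' (q ∘ₗ u) (p ∘ₗ v) (by
      rw [LinearMap.comp_assoc, huv, ← LinearMap.comp_assoc, hpl, LinearMap.comp_assoc])
    obtain ⟨w₀, hw₀⟩ := Module.projective_lifting_property q w'' hE.surj
    obtain ⟨u', hu'⟩ := hE.exists_lift (v := u - w₀ ∘ₗ i') (by
      rw [LinearMap.comp_sub, ← LinearMap.comp_assoc, hw₀, hw'', sub_self])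
    obtain ⟨v', hv'⟩ := h.exists_lift (v := v - l ∘ₗ w₀) (by
      rw [LinearMap.comp_sub, ← LinearMap.comp_assoc, hpl, LinearMap.comp_assoc, hw₀, haw'',
        sub_self])
    obtain ⟨w', hw', haw'⟩ := ha' i' p' hs' hP1 hP2 hB' u' v' (by
      rw [← LinearMap.cancel_left h.inj, ← LinearMap.comp_assoc, hv', ← LinearMap.comp_assoc,
        ← hlj, LinearMap.comp_assoc, hu', LinearMap.sub_comp, LinearMap.comp_sub, huv,
        LinearMap.comp_assoc])
    refine ⟨w₀ + j ∘ₗ w', ?_, ?_⟩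
    · rw [LinearMap.add_comp, LinearMap.comp_assoc, hw', hu', add_sub_cancel]
    · rw [LinearMap.comp_add, ← LinearMap.comp_assoc, hlj, LinearMap.comp_assoc, haw', hv',
        add_sub_cancel]
  · exact Module.Finite.of_exact hE.exact hE.surj

lemma hasSpecialApprox_of_isFiniteLength [IsNoetherianRing Λ] {d : ℕ}
    (hd : ∀ S : ModuleCat.{u} Λ, IsSimpleModule Λ S → HasSpecialApprox d S)
    (M : Type u) [AddCommGroup M] [Module Λ M] (hM : IsFiniteLength Λ M) :
    HasSpecialApprox d (ModuleCat.of Λ M) := by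
  induction hM with
  | @of_subsingleton M _ _ _ =>
    have : Module.Finite Λ (ModuleCat.of Λ M) := inferInstanceAs (Module.Finite Λ M)
    have : Module.Projective Λ M := inferInstance
    refine ⟨ModuleCat.of Λ M, LinearMap.id, Function.surjective_id, ?_, ‹_›,
      HasProjDimLE.mono (n := 0) this (Nat.zero_le d)⟩
    intro K P B i p _ _ _ _ u v huv
    exact ⟨v, huv, rfl⟩
  | @of_simple_quotient M _ _ N _ hN ih =>
    exact IsSES.hasSpecialApprox_mid (A := ModuleCat.of Λ N) (B := ModuleCat.of Λ M)
      (C := ModuleCat.of Λ (M ⧸ N)) (i := N.subtype) (p := N.mkQ)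
      ⟨N.injective_subtype, LinearMap.exact_subtype_mkQ N, N.mkQ_surjective⟩ ih
      (hd (ModuleCat.of Λ (M ⧸ N)) ‹_›)

end Approximation

section Minimal

variable {Λ : Type u} [Ring Λ] {A A' X : ModuleCat.{u} Λ}

lemma _root_.IsRightApprox.finProj {f : A →ₗ[Λ] X} (hf : IsRightApprox Λ X A f) : FinProj A :=
  ⟨hf.1, hf.2.1⟩

lemma _root_.IsRightApprox.surjective [Module.Finite Λ X] {f : A →ₗ[Λ] X}
    (hf : IsRightApprox Λ X A f) : Function.Surjective f := by
  obtain ⟨K, P, i, p, hs, hP, hP'⟩ := exists_isSES_of_finite X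
  have hPf : FinProj P := finProj_of_projective
  obtain ⟨h, hh⟩ := hf.2.2 P hPf.1 hPf.2 p
  refine Function.Surjective.of_comp (g := h) ?_
  rw [← LinearMap.coe_comp, hh]
  exact hs.surj

/-- A right `P^∞(Λ-mod)`-approximation `f` is minimal if the endomorphisms `h` with `f ∘ h = f`
are automorphisms. -/
def IsMinApprox (f : A →ₗ[Λ] X) : Prop :=
  IsRightApprox Λ X A f ∧ ∀ h : A →ₗ[Λ] A, f ∘ₗ h = f → Function.Bijective h

lemma IsMinApprox.exists_retraction {f : A →ₗ[Λ] X} (hf : IsMinApprox f) {f' : A' →ₗ[Λ] X}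
    (hf' : IsRightApprox Λ X A' f') :
    ∃ (s : A →ₗ[Λ] A') (r : A' →ₗ[Λ] A), r ∘ₗ s = LinearMap.id := by
  obtain ⟨s, hs⟩ := hf'.2.2 A hf.1.1 hf.1.2.1 f
  obtain ⟨r, hr⟩ := hf.1.2.2 A' hf'.1 hf'.2.1 f'
  have hbij := hf.2 (r ∘ₗ s) (by rw [← LinearMap.comp_assoc, hr, hs])
  let e := LinearEquiv.ofBijective (r ∘ₗ s) hbij
  refine ⟨s, e.symm.toLinearMap ∘ₗ r, ?_⟩
  ext x
  exact e.symm_apply_apply x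

/-- Minimal right approximations satisfy the lifting property of Wakamatsu's lemma. -/
lemma IsMinApprox.hasLifting [IsNoetherianRing Λ] {f : A →ₗ[Λ] X} (hf : IsMinApprox f) :
    HasLifting f := by
  intro K P B i p hs hP hP' hB u v huv
  obtain ⟨E, j, k, q, hE, -, hki, -, hl, -, -⟩ := hs.exists_pushout u
  obtain ⟨l, hlj, hlk⟩ := hl X f v huv
  have hEf : FinProj E := hE.finProj_mid hf.1.finProj hB
  obtain ⟨h, hh⟩ := hf.1.2.2 E hEf.1 hEf.2 l
  have hfj : f ∘ₗ (h ∘ₗ j) = f := by rw [← LinearMap.comp_assoc, hh, hlj]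
  let e := LinearEquiv.ofBijective (h ∘ₗ j) (hf.2 _ hfj)
  have hfe : f ∘ₗ e.symm.toLinearMap = f := by
    ext x
    have := LinearMap.congr_fun hfj (e.symm x)
    simp only [LinearMap.comp_apply] at this ⊢
    rw [LinearEquiv.coe_coe, ← this]
    exact congrArg f (e.apply_symm_apply x)
  refine ⟨e.symm.toLinearMap ∘ₗ h ∘ₗ k, ?_, ?_⟩
  · rw [LinearMap.comp_assoc, LinearMap.comp_assoc, hki]
    ext x
    exact e.symm_apply_apply (u x)
  · rw [← LinearMap.comp_assoc, hfe, ← LinearMap.comp_assoc, hh, hlk]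

lemma IsMinApprox.hasSpecialApprox [IsNoetherianRing Λ] [Module.Finite Λ X] {f : A →ₗ[Λ] X}
    (hf : IsMinApprox f) {d : ℕ} (hd : HasProjDimLE Λ d A) : HasSpecialApprox d X :=
  ⟨A, f, hf.1.surjective, hf.hasLifting, hf.1.1, hd⟩

lemma eq_top_of_finrank_le (K : Type u) [Field K] [Algebra K Λ] [FiniteDimensional K Λ]
    {M : Type u} [AddCommGroup M] [Module Λ M] [Module.Finite Λ M]
    (R : Submodule Λ M)
    (h : Module.finrank K (RestrictScalars K Λ M) ≤ Module.finrank K (RestrictScalars K Λ R)) :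
    R = ⊤ := by
  let : Module K M := Module.compHom M (algebraMap K Λ)
  have : IsScalarTower K Λ M := RestrictScalars.isScalarTower K Λ M
  have : Module.Finite K M := Module.Finite.trans Λ M
  have h2 : Module.finrank K (R.restrictScalars K) = Module.finrank K M :=
    le_antisymm (Submodule.finrank_le _) h
  have h1 := Submodule.eq_top_of_finrank_eq h2
  ext x
  rw [← Submodule.restrictScalars_mem K, h1]
  simp

lemma isMinApprox_of_finrank (K : Type u) [Field K] [Algebra K Λ] [FiniteDimensional K Λ]
    {f : A →ₗ[Λ] X} (hf : IsRightApprox Λ X A f)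
    (hmin : ∀ (A' : ModuleCat.{u} Λ) (f' : A' →ₗ[Λ] X), IsRightApprox Λ X A' f' →
      Module.finrank K (RestrictScalars K Λ A) ≤ Module.finrank K (RestrictScalars K Λ A')) :
    IsMinApprox f := by
  refine ⟨hf, fun h hh => ?_⟩
  have := hf.1
  have : IsArtinianRing Λ := IsArtinianRing.of_finite K Λ
  obtain ⟨n, hn, hn1⟩ := ((h.eventually_isCompl_ker_pow_range_pow).and
    (Filter.eventually_ge_atTop 1)).exists
  have hfn : ∀ m x, f ((h ^ m) x) = f x := by
    intro m
    induction m with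
    | zero => intro x; rfl
    | succ m ih => intro x; rw [pow_succ, Module.End.mul_apply, ih]; exact LinearMap.congr_fun hh x
  let R := LinearMap.range (h ^ n)
  have hR : IsRightApprox Λ X (ModuleCat.of Λ R) (f ∘ₗ R.subtype) := by
    obtain ⟨d, hd⟩ := hf.2.1
    refine ⟨inferInstanceAs (Module.Finite Λ R), ⟨d, ?_⟩, ?_⟩
    · refine hd.of_retract (N := ModuleCat.of Λ R) (s := R.subtype)
        (r := R.projectionOnto _ hn.symm) ?_
      ext x
      exact congrArg Subtype.val (Submodule.projectionOnto_apply_left hn.symm x)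
    · intro B hB hB' g
      obtain ⟨t, ht⟩ := hf.2.2 B hB hB' g
      refine ⟨(h ^ n).rangeRestrict ∘ₗ t, ?_⟩
      ext x
      exact (hfn n (t x)).trans (LinearMap.congr_fun ht x)
  have htop : R = ⊤ := eq_top_of_finrank_le K R (hmin _ _ hR)
  have hsurj : Function.Surjective h := by
    obtain ⟨m, rfl⟩ : ∃ m, n = m + 1 := ⟨n - 1, by lia⟩
    intro y
    obtain ⟨x, hx⟩ : y ∈ LinearMap.range (h ^ (m + 1)) := by
      change y ∈ R; rw [htop]; trivial
    exact ⟨(h ^ m) x, by rw [← hx, pow_succ']; rfl⟩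
  exact IsNoetherian.bijective_of_surjective_endomorphism h hsurj

lemma exists_isMinApprox (K : Type u) [Field K] [Algebra K Λ] [FiniteDimensional K Λ]
    (hcf : ContravariantlyFinite Λ) (X : ModuleCat.{u} Λ)
    [hX : Module.Finite Λ X] :
    ∃ (A : ModuleCat.{u} Λ) (f : A →ₗ[Λ] X), IsMinApprox f := by
  classical
  let s : Set ℕ := {n | ∃ (A : ModuleCat.{u} Λ) (f : A →ₗ[Λ] X), IsRightApprox Λ X A f ∧
    Module.finrank K (RestrictScalars K Λ A) = n}
  have hs : s.Nonempty := by
    obtain ⟨A, f, hf⟩ := hcf X hX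
    exact ⟨_, A, f, hf, rfl⟩
  obtain ⟨A, f, hf, hA⟩ := Nat.sInf_mem hs
  refine ⟨A, f, isMinApprox_of_finrank K hf fun A' f' hf' => ?_⟩
  rw [hA]
  exact Nat.sInf_le ⟨A', f', hf', rfl⟩

/-- The projective dimensions of the minimal approximations of the simple modules are bounded. -/
lemma exists_bound_of_isMinApprox (K : Type u) [Field K] [Algebra K Λ] [FiniteDimensional K Λ]
    (hcf : ContravariantlyFinite Λ) :
    ∃ n : ℕ, ∀ (S A : ModuleCat.{u} Λ) (f : A →ₗ[Λ] S), IsSimpleModule Λ S → IsMinApprox f →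
      HasProjDimLE Λ n A := by
  have : IsArtinianRing Λ := IsArtinianRing.of_finite K Λ
  let J := Module.jacobson Λ Λ
  obtain ⟨A₀, f₀, hf₀⟩ := exists_isMinApprox K hcf (ModuleCat.of Λ (Λ ⧸ J))
    (hX := inferInstanceAs (Module.Finite Λ (Λ ⧸ J)))
  obtain ⟨n, hn⟩ := hf₀.1.2.1
  refine ⟨n, fun S A f hS hf => ?_⟩
  have hss : IsSemisimpleModule Λ (Λ ⧸ J) := by
    rw [IsArtinian.isSemisimpleModule_iff_jacobson]
    exact Module.jacobson_quotient_jacobson Λ Λ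
  have := IsSimpleModule.nontrivial Λ S
  obtain ⟨x, hx⟩ := exists_ne (0 : S)
  let t : Λ →ₗ[Λ] S := LinearMap.toSpanSingleton Λ S x
  have ht : Function.Surjective t := IsSimpleModule.toSpanSingleton_surjective Λ hx
  let t' : (Λ ⧸ J) →ₗ[Λ] S := J.liftQ t (IsSemisimpleModule.jacobson_le_ker Λ Λ Λ S t)
  have ht' : Function.Surjective t' := by
    intro y
    obtain ⟨z, rfl⟩ := ht y
    exact ⟨J.mkQ z, J.liftQ_apply t z⟩
  obtain ⟨s, hs⟩ := IsSemisimpleModule.lifting_property t' ht' LinearMap.id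
  have hS' : IsRightApprox Λ S A₀ (t' ∘ₗ f₀) := by
    refine ⟨hf₀.1.1, hf₀.1.2.1, fun B hB hB' g => ?_⟩
    obtain ⟨w, hw⟩ := hf₀.1.2.2 B hB hB' (s ∘ₗ g)
    refine ⟨w, ?_⟩
    rw [LinearMap.comp_assoc, hw, ← LinearMap.comp_assoc, hs, LinearMap.id_comp]
  obtain ⟨i, r, hir⟩ := hf.exists_retraction hS'
  exact hn.of_retract hir

end Minimal

section Cogenerator

/-- The `K`-dual of the right regular module, a left `Λ`-module. -/
def RegularDual (K Λ : Type u) [Field K] [Ring Λ] [Algebra K Λ] : Type u := Λ →ₗ[K] K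

namespace RegularDual

variable {K Λ : Type u} [Field K] [Ring Λ] [Algebra K Λ]

instance : AddCommGroup (RegularDual K Λ) := inferInstanceAs (AddCommGroup (Λ →ₗ[K] K))

instance : Module K (RegularDual K Λ) := inferInstanceAs (Module K (Λ →ₗ[K] K))

instance : FunLike (RegularDual K Λ) Λ K := inferInstanceAs (FunLike (Λ →ₗ[K] K) Λ K)

instance : AddMonoidHomClass (RegularDual K Λ) Λ K :=
  inferInstanceAs (AddMonoidHomClass (Λ →ₗ[K] K) Λ K)

lemma add_apply (f g : RegularDual K Λ) (x : Λ) : (f + g) x = f x + g x := rfl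

lemma zero_apply (x : Λ) : (0 : RegularDual K Λ) x = 0 := rfl

instance : SMul Λ (RegularDual K Λ) := ⟨fun a f => LinearMap.comp f (LinearMap.mulRight K a)⟩

lemma smul_apply (a : Λ) (f : RegularDual K Λ) (x : Λ) : (a • f) x = f (x * a) := rfl

lemma map_smul' (c : K) (f : RegularDual K Λ) (x : Λ) : f (c • x) = c * f x :=
  LinearMap.map_smul (f : Λ →ₗ[K] K) c x

lemma ext' {f g : RegularDual K Λ} (h : ∀ x, f x = g x) : f = g := DFunLike.ext f g h

instance : Module Λ (RegularDual K Λ) where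
  one_smul f := ext' fun x => by rw [smul_apply, mul_one]
  mul_smul a b f := ext' fun x => by rw [smul_apply, smul_apply, smul_apply, mul_assoc]
  smul_zero a := rfl
  smul_add a f g := rfl
  add_smul a b f := ext' fun x => by
    rw [smul_apply, mul_add, map_add]; rfl
  zero_smul f := ext' fun x => by rw [smul_apply, mul_zero, map_zero, zero_apply]

instance : IsScalarTower K Λ (RegularDual K Λ) where
  smul_assoc c a f := ext' fun x => by
    rw [smul_apply, mul_smul_comm, map_smul', ← smul_apply]
    rfl

instance [FiniteDimensional K Λ] : Module.Finite Λ (RegularDual K Λ) :=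
  have : Module.Finite K (RegularDual K Λ) := inferInstanceAs (Module.Finite K (Λ →ₗ[K] K))
  Module.Finite.of_restrictScalars_finite K Λ _

variable {M N : Type u} [AddCommGroup M] [Module Λ M] [Module K M] [IsScalarTower K Λ M]
  [AddCommGroup N] [Module Λ N] [Module K N] [IsScalarTower K Λ N]

/-- The homomorphism into the dual of the regular module attached to a linear form. -/
def lift (θ : M →ₗ[K] K) : M →ₗ[Λ] RegularDual K Λ where
  toFun m := θ ∘ₗ (LinearMap.toSpanSingleton Λ M m).restrictScalars K
  map_add' m n := ext' fun x => by
    change θ (x • (m + n)) = θ (x • m) + θ (x • n)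
    rw [smul_add, map_add]
  map_smul' a m := ext' fun x => by
    change θ (x • a • m) = θ ((x * a) • m)
    rw [mul_smul]

lemma lift_apply (θ : M →ₗ[K] K) (m : M) (x : Λ) : lift θ m x = θ (x • m) := rfl

lemma exists_extend {i : M →ₗ[Λ] N} (hi : Function.Injective i) (φ : M →ₗ[Λ] RegularDual K Λ) :
    ∃ ψ : N →ₗ[Λ] RegularDual K Λ, ψ ∘ₗ i = φ := by
  let θ : M →ₗ[K] K :=
    { toFun m := φ m 1
      map_add' m n := by rw [map_add, add_apply]
      map_smul' c m := by
        rw [← algebraMap_smul Λ c m, map_smul, smul_apply, one_mul, Algebra.algebraMap_eq_smul_one,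
          map_smul']
        rfl }
  obtain ⟨g, hg⟩ := (i.restrictScalars K).exists_leftInverse_of_injective
    (LinearMap.ker_eq_bot.2 hi)
  refine ⟨lift (θ ∘ₗ g), LinearMap.ext fun m => ext' fun x => ?_⟩
  rw [LinearMap.comp_apply, lift_apply, ← map_smul]
  have := LinearMap.congr_fun hg (x • m)
  simp only [LinearMap.comp_apply, LinearMap.restrictScalars_apply, LinearMap.id_apply] at this ⊢
  rw [this]
  change φ (x • m) 1 = _
  rw [map_smul, smul_apply, one_mul]

end RegularDual

lemma exists_relative_injective_cogenerator (K : Type u) {Λ : Type u} [Field K] [Ring Λ]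
    [Algebra K Λ] [FiniteDimensional K Λ] (hcf : ContravariantlyFinite Λ) :
    ∃ T : ModuleCat.{u} Λ, FinProj T ∧ (∀ X, FinProj X → ExtVanish 1 X T) ∧
      ∀ X : ModuleCat.{u} Λ, FinProj X →
        ∃ (ι : Type u) (j : X →ₗ[Λ] (ι →₀ T)), Finite ι ∧ Function.Injective j := by
  have : IsArtinianRing Λ := IsArtinianRing.of_finite K Λ
  obtain ⟨T, f, hf⟩ := exists_isMinApprox K hcf (ModuleCat.of Λ (RegularDual K Λ))
    (hX := inferInstanceAs (Module.Finite Λ (RegularDual K Λ)))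
  refine ⟨T, hf.1.finProj, fun X hX => ?_, fun X hX => ?_⟩
  · have := hX.1
    obtain ⟨N, P, i, p, hs, hP, hP'⟩ := exists_isSES_of_finite X
    refine hs.extVanish_one (extVanish_of_projective T 0) fun φ => ?_
    let : Module K N := Module.compHom N (algebraMap K Λ)
    have : IsScalarTower K Λ N := RestrictScalars.isScalarTower K Λ N
    let : Module K P := Module.compHom P (algebraMap K Λ)
    have : IsScalarTower K Λ P := RestrictScalars.isScalarTower K Λ P
    obtain ⟨v, hv⟩ := RegularDual.exists_extend (K := K) hs.inj (f ∘ₗ φ)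
    obtain ⟨w, hw, -⟩ := hf.hasLifting i p hs hP hP' hX φ v hv
    exact ⟨w, hw⟩
  · have := hX.1
    let : Module K X := Module.compHom X (algebraMap K Λ)
    have : IsScalarTower K Λ X := RestrictScalars.isScalarTower K Λ X
    have : Module.Finite K X := Module.Finite.trans Λ X
    let b := Module.Basis.ofVectorSpace K X
    choose h hh using fun k => hf.1.2.2 X hX.1 hX.2 (RegularDual.lift (b.coord k))
    refine ⟨Module.Basis.ofVectorSpaceIndex K X,
      (Finsupp.linearEquivFunOnFinite Λ T _).symm.toLinearMap ∘ₗ LinearMap.pi h, inferInstance, ?_⟩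
    rw [LinearMap.coe_comp]
    refine (LinearEquiv.injective _).comp ((injective_iff_map_eq_zero _).2 fun x hx => ?_)
    refine b.ext_elem fun k => ?_
    have h1 : RegularDual.lift (Λ := Λ) (b.coord k) x = 0 := by
      rw [← LinearMap.congr_fun (hh k) x, LinearMap.comp_apply, show h k x = 0 from congrFun hx k,
        map_zero]
    have h2 := RegularDual.lift_apply (Λ := Λ) (b.coord k) x 1
    rw [h1, RegularDual.zero_apply, one_smul] at h2
    simpa using h2.symm

end Cogenerator

section Copower

variable {Λ : Type u} [Ring Λ] {A B C T X Y : ModuleCat.{u} Λ} {i : A →ₗ[Λ] B} {p : B →ₗ[Λ] C}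

/-- The direct sum of copies of `M` indexed by `I`. -/
noncomputable abbrev copower (I : Type u) (M : ModuleCat.{u} Λ) : ModuleCat.{u} Λ :=
  ModuleCat.of Λ (I →₀ M)

/-- The map of direct sums of copies induced by a homomorphism. -/
noncomputable abbrev copowerMap (I : Type u) (f : A →ₗ[Λ] B) : copower I A →ₗ[Λ] copower I B :=
  Finsupp.mapRange.linearMap f

lemma copowerMap_apply (I : Type u) (f : A →ₗ[Λ] B) (x : copower I A) (k : I) :
    copowerMap I f x k = f (x k) := by
  simp

lemma copowerMap_comp_id (I : Type u) {r : B →ₗ[Λ] A} (h : r ∘ₗ i = LinearMap.id) :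
    copowerMap I r ∘ₗ copowerMap I i = LinearMap.id := by
  rw [← Finsupp.mapRange.linearMap_comp, h, Finsupp.mapRange.linearMap_id]

lemma IsSES.copower (h : IsSES i p) (I : Type u) : IsSES (copowerMap I i) (copowerMap I p) where
  inj := Finsupp.mapRange_injective i (map_zero i) h.inj
  exact := by
    intro y
    constructor
    · intro hy
      choose a ha using fun k => (h.exact (y k)).1 (by
        rw [← copowerMap_apply, hy]; rfl)
      refine ⟨Finsupp.onFinset y.support a fun k hk => ?_, Finsupp.ext fun k => ?_⟩
      · rw [Finsupp.mem_support_iff, ← ha]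
        exact fun h0 => hk (h.inj (h0.trans (map_zero i).symm))
      · rw [copowerMap_apply, Finsupp.onFinset_apply, ha]
    · rintro ⟨x, rfl⟩
      exact Finsupp.ext fun k => by
        rw [copowerMap_apply, copowerMap_apply, h.apply_apply_eq_zero]; rfl
  surj := Finsupp.mapRange_surjective p (map_zero p) h.surj

instance projective_copower [Module.Projective Λ X] (I : Type u) :
    Module.Projective Λ (copower I X) := by
  classical
  exact Module.Projective.of_equiv (finsuppLequivDFinsupp (ι := I) (M := X) Λ).symm

lemma hasProjDimLE_copower {d : ℕ} (h : HasProjDimLE Λ d X) (I : Type u) :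
    HasProjDimLE Λ d (copower I X) := by
  induction d generalizing X with
  | zero =>
    have : Module.Projective Λ X := h
    exact projective_copower I
  | succ d ih =>
    obtain ⟨P, g, hP, hg, hd⟩ := h
    have hP' : HasProjDimLE Λ 0 (copower I P) :=
      projective_copower I
    exact ((isSES_ker hg).copower I).hasProjDimLE_right (ih hd) (hP'.mono (by lia))

lemma finProj_copower (h : FinProj X) (I : Type u) [Finite I] : FinProj (copower I X) := by
  obtain ⟨_, d, hd⟩ := h
  exact ⟨inferInstanceAs (Module.Finite Λ (I →₀ X)), d, hasProjDimLE_copower hd I⟩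

lemma exists_finset_support_subset [Module.Finite Λ X] {I : Type u} (φ : X →ₗ[Λ] copower I T) :
    ∃ s : Finset I, ∀ x, (φ x).support ⊆ s := by
  classical
  obtain ⟨t, ht⟩ := (Module.Finite.fg_top : (⊤ : Submodule Λ X).FG)
  refine ⟨t.biUnion fun x => (φ x).support, fun x => ?_⟩
  have hle : (⊤ : Submodule Λ X) ≤ (Finsupp.supported T Λ
      (↑(t.biUnion fun x => (φ x).support) : Set I)).comap φ := by
    rw [← ht, Submodule.span_le]
    intro x hx
    refine (Finsupp.mem_supported Λ _).2 ?_
    exact_mod_cast Finset.subset_biUnion_of_mem (fun x => (φ x).support) hx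
  exact_mod_cast (Finsupp.mem_supported Λ _).1 (hle (Submodule.mem_top (x := x)))

/-- `Y` is right `Ext¹`-orthogonal to `P^∞(Λ-mod)`. -/
def ExtOrthogonal (Y : ModuleCat.{u} Λ) : Prop := ∀ X : ModuleCat.{u} Λ, FinProj X → ExtVanish 1 X Y

lemma extOrthogonal_copower [IsNoetherianRing Λ] (hT : ExtOrthogonal T) (I : Type u) :
    ExtOrthogonal (copower I T) := by
  intro X hX
  have := hX.1
  obtain ⟨N, P, i, p, hs, hP, hP'⟩ := exists_isSES_of_finite X
  refine hs.extVanish_one (extVanish_of_projective _ 0) fun φ => ?_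
  have : Module.Finite Λ N := Module.Finite.of_injective i hs.inj
  obtain ⟨s, hsupp⟩ := exists_finset_support_subset φ
  choose ψ hψ using fun k => hs.extend (hT X hX) (Finsupp.lapply k ∘ₗ φ)
  refine ⟨∑ k ∈ s, Finsupp.lsingle k ∘ₗ ψ k, LinearMap.ext fun n => ?_⟩
  have hn : φ n = ∑ k ∈ s, Finsupp.single k (φ n k) := by
    rw [← Finsupp.sum_of_support_subset (φ n) (hsupp n) Finsupp.single (by simp),
      Finsupp.sum_single]
  rw [hn, LinearMap.comp_apply, LinearMap.sum_apply]
  refine Finset.sum_congr rfl fun k _ => ?_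
  exact congrArg (Finsupp.single k) (LinearMap.congr_fun (hψ k) n)

lemma ExtOrthogonal.extVanish_copower [IsNoetherianRing Λ] (hY : ExtOrthogonal Y) (j : ℕ)
    (J : Type u) (hX : FinProj X) : ExtVanish (j + 1) (copower J X) Y := by
  induction j generalizing X with
  | zero =>
    have := hX.1
    obtain ⟨N, P, i, p, hs, hP, hP'⟩ := exists_isSES_of_finite X
    refine (hs.copower J).extVanish_one (extVanish_of_projective _ 0) fun φ => ?_
    choose ψ hψ using fun k => hs.extend (hY X hX) (φ ∘ₗ Finsupp.lsingle k)
    refine ⟨Finsupp.lsum ℕ ψ, Finsupp.lhom_ext' fun k => ?_⟩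
    rw [← hψ]
    ext x
    simp
  | succ j ih =>
    have := hX.1
    obtain ⟨N, P, i, p, hs, hP, hP'⟩ := exists_isSES_of_finite X
    exact (hs.copower J).extVanish_right (ih (hs.finProj_left finProj_of_projective hX))
      (extVanish_of_projective _ _)

lemma ExtOrthogonal.extVanish [IsNoetherianRing Λ] (hY : ExtOrthogonal Y) (j : ℕ)
    (hX : FinProj X) : ExtVanish (j + 1) X Y :=
  (hY.extVanish_copower j PUnit hX).of_retract
    (s := (Finsupp.lsingle PUnit.unit : X →ₗ[Λ] copower PUnit X))
    (r := Finsupp.lapply PUnit.unit) (LinearMap.ext fun x => by simp)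

end Copower

section Coresolution

variable {Λ : Type u} [Ring Λ] {A B C T X Y : ModuleCat.{u} Λ} {i : A →ₗ[Λ] B} {p : B →ₗ[Λ] C}

lemma IsSES.exists_section (h : IsSES i p) {r : B →ₗ[Λ] A} (hr : r ∘ₗ i = LinearMap.id) :
    ∃ t : C →ₗ[Λ] B, p ∘ₗ t = LinearMap.id ∧ t ∘ₗ p = LinearMap.id - i ∘ₗ r := by
  obtain ⟨t, ht⟩ := h.exists_desc (v := LinearMap.id - i ∘ₗ r) (by
    rw [LinearMap.sub_comp, LinearMap.comp_assoc, hr, LinearMap.id_comp, LinearMap.comp_id,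
      sub_self])
  refine ⟨t, ?_, ht⟩
  rw [← LinearMap.cancel_right h.surj, LinearMap.comp_assoc, ht, LinearMap.comp_sub,
    ← LinearMap.comp_assoc, h.comp_eq_zero]
  ext x
  simp

lemma IsSES.comp_equiv (h : IsSES i p) (e : B ≃ₗ[Λ] Y) :
    IsSES (e.toLinearMap ∘ₗ i) (p ∘ₗ e.symm.toLinearMap) where
  inj := e.injective.comp h.inj
  exact := by
    intro y
    rw [LinearMap.comp_apply, h.exact]
    constructor
    · rintro ⟨a, ha⟩
      exact ⟨a, by simp [ha]⟩
    · rintro ⟨a, rfl⟩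
      exact ⟨a, by simp⟩
  surj := h.surj.comp e.symm.surjective

/-- The nine lemma in the form used to splice coresolutions. -/
lemma IsSES.exists_isSES_coker (h : IsSES i p) {A₀ A₁ C₀ C₁ : ModuleCat.{u} Λ}
    {a : A →ₗ[Λ] A₀} {a' : A₀ →ₗ[Λ] A₁} (ha : IsSES a a') {c : C →ₗ[Λ] C₀} {c' : C₀ →ₗ[Λ] C₁}
    (hc : IsSES c c') {α : B →ₗ[Λ] A₀} (hα : α ∘ₗ i = a) :
    ∃ (B₁ : ModuleCat.{u} Λ) (b : B →ₗ[Λ] ModuleCat.of Λ (A₀ × C₀))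
      (b' : ModuleCat.of Λ (A₀ × C₀) →ₗ[Λ] B₁) (j : A₁ →ₗ[Λ] B₁) (q : B₁ →ₗ[Λ] C₁),
      IsSES b b' ∧ IsSES j q := by
  let b : B →ₗ[Λ] ModuleCat.of Λ (A₀ × C₀) := α.prod (c ∘ₗ p)
  have hαi : ∀ x, α (i x) = a x := LinearMap.congr_fun hα
  have hbi : ∀ x, b (i x) = (a x, 0) := fun x => by
    simp [b, hαi, h.apply_apply_eq_zero]
  have hb : Function.Injective b := by
    rw [injective_iff_map_eq_zero]
    intro y hy
    have h1 : α y = 0 := congrArg Prod.fst hy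
    have h2 : c (p y) = 0 := congrArg Prod.snd hy
    obtain ⟨x, rfl⟩ := (h.exact y).1 (hc.inj (h2.trans (map_zero c).symm))
    rw [hαi] at h1
    rw [ha.inj (h1.trans (map_zero a).symm), map_zero]
  have hs := isSES_quotient hb
  let b' := (LinearMap.range b).mkQ
  obtain ⟨j, hj⟩ := ha.exists_desc (Y := ModuleCat.of Λ (_ ⧸ LinearMap.range b))
    (v := b' ∘ₗ LinearMap.inl Λ A₀ C₀) (by
      ext x
      have := hs.apply_apply_eq_zero (i x)
      rw [hbi] at this
      exact this)
  obtain ⟨q, hq⟩ := hs.exists_desc (v := c' ∘ₗ LinearMap.snd Λ A₀ C₀) (by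
    ext x
    exact hc.apply_apply_eq_zero (p x))
  have hj' : ∀ x, j (a' x) = b' (x, 0) := LinearMap.congr_fun hj
  have hq' : ∀ x, q (b' x) = c' x.2 := LinearMap.congr_fun hq
  refine ⟨_, b, b', j, q, hs, ?_, ?_, ?_⟩
  · rw [injective_iff_map_eq_zero]
    intro y hy
    obtain ⟨x, rfl⟩ := ha.surj y
    rw [hj'] at hy
    obtain ⟨z, hz⟩ := (hs.exact _).1 hy
    have h1 : α z = x := congrArg Prod.fst hz
    have h2 : c (p z) = 0 := congrArg Prod.snd hz
    obtain ⟨w, rfl⟩ := (h.exact z).1 (hc.inj (h2.trans (map_zero c).symm))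
    rw [← h1, hαi, ha.apply_apply_eq_zero]
  · intro y
    obtain ⟨⟨x, z⟩, rfl⟩ := hs.surj y
    constructor
    · intro hy
      obtain ⟨w, hw⟩ := (hc.exact z).1 ((hq' (x, z)).symm.trans hy)
      obtain ⟨w, rfl⟩ := h.surj w
      refine ⟨a' (x - α w), ?_⟩
      rw [hj']
      refine (Submodule.Quotient.eq _).2 ⟨-w, ?_⟩
      simp [b, hw]
    · rintro ⟨w, hw⟩
      obtain ⟨v, rfl⟩ := ha.surj w
      rw [← hw, hj', hq', map_zero]
  · intro y
    obtain ⟨x, rfl⟩ := hc.surj y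
    exact ⟨b' (0, x), hq' (0, x)⟩

/-- `N` has a coresolution of length `m` by direct summands of direct sums of copies of `T`, all
terms but the last being direct sums of copies of `T`. -/
def Cores (T : ModuleCat.{u} Λ) : ℕ → ModuleCat.{u} Λ → Prop
  | 0, N => ∃ (I : Type u) (s : N →ₗ[Λ] copower I T) (r : copower I T →ₗ[Λ] N),
      r ∘ₗ s = LinearMap.id
  | m + 1, N => ∃ (I : Type u) (C : ModuleCat.{u} Λ) (i : N →ₗ[Λ] copower I T)
      (p : copower I T →ₗ[Λ] C), IsSES i p ∧ Cores T m C

lemma Cores.succ {m : ℕ} (h : Cores T m X) : Cores T (m + 1) X := by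
  induction m generalizing X with
  | zero =>
    obtain ⟨I, s, r, hrs⟩ := h
    have hs := isSES_quotient (i := s) (Function.LeftInverse.injective (LinearMap.congr_fun hrs))
    obtain ⟨t, ht, -⟩ := hs.exists_section hrs
    exact ⟨I, _, s, _, hs, I, t, _, ht⟩
  | succ m ih =>
    obtain ⟨I, C, i, p, hs, hC⟩ := h
    exact ⟨I, C, i, p, hs, ih hC⟩

lemma Cores.mono {m n : ℕ} (h : Cores T m X) (hmn : m ≤ n) : Cores T n X := by
  induction n, hmn using Nat.le_induction with
  | base => exact h
  | succ n _ ih => exact ih.succ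

lemma Cores.extVanish [IsNoetherianRing Λ] {m : ℕ} (hX : Cores T m X) (hT : FinProj T)
    (hY : ExtOrthogonal Y) (j : ℕ) : ExtVanish (j + 1) X Y := by
  induction m generalizing X j with
  | zero =>
    obtain ⟨I, s, r, hrs⟩ := hX
    exact (hY.extVanish_copower j I hT).of_retract hrs
  | succ m ih =>
    obtain ⟨I, C, i, p, hs, hC⟩ := hX
    exact hs.extVanish_left (hY.extVanish_copower j I hT) (ih hC (j + 1))

lemma Cores.of_isSES [IsNoetherianRing Λ] (hT : FinProj T) (hT' : ExtOrthogonal T) {m : ℕ}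
    (h : IsSES i p) (hA : Cores T m A) (hC : Cores T m C) : Cores T m B := by
  induction m generalizing A B C with
  | zero =>
    have hCext := fun I => hC.extVanish hT (extOrthogonal_copower hT' I) 0
    obtain ⟨I, s, r, hrs⟩ := hA
    obtain ⟨J, s', r', hrs'⟩ := hC
    obtain ⟨ρ, hρ⟩ := h.extend (hCext I) s
    obtain ⟨t, -, ht⟩ := h.exists_section (r := r ∘ₗ ρ) (by rw [LinearMap.comp_assoc, hρ, hrs])
    let e := Finsupp.sumFinsuppLEquivProdFinsupp (M := T) (α := I) (β := J) Λ
    refine ⟨I ⊕ J, e.symm.toLinearMap ∘ₗ (ρ.prod (s' ∘ₗ p)),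
      ((i ∘ₗ r).coprod (t ∘ₗ r')) ∘ₗ e.toLinearMap, LinearMap.ext fun b => ?_⟩
    have h1 := LinearMap.congr_fun ht b
    have h2 := LinearMap.congr_fun hrs' (p b)
    simp only [LinearMap.comp_apply, LinearMap.sub_apply, LinearMap.id_apply] at h1 h2
    simp [h1, h2]
  | succ m ih =>
    have hCext := fun I => hC.extVanish hT (extOrthogonal_copower hT' I) 0
    obtain ⟨I, A₁, a, a', ha, hA₁⟩ := hA
    obtain ⟨J, C₁, c, c', hc, hC₁⟩ := hC
    obtain ⟨α, hα⟩ := h.extend (hCext I) a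
    obtain ⟨B₁, b, b', j, q, hb, hj⟩ := h.exists_isSES_coker ha hc hα
    let e := Finsupp.sumFinsuppLEquivProdFinsupp (M := T) (α := I) (β := J) Λ
    exact ⟨I ⊕ J, B₁, _, _, hb.comp_equiv (Y := copower (I ⊕ J) T) e.symm, ih hj hA₁ hC₁⟩

lemma Cores.copower {m : ℕ} (h : Cores T m X) (J : Type u) :
    Cores T m (FinitisticDimension.copower J X) := by
  induction m generalizing X with
  | zero =>
    obtain ⟨I, s, r, hrs⟩ := h
    let e := Finsupp.curryLinearEquiv (α := J) (β := I) (M := T) Λ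
    refine ⟨J × I, e.symm.toLinearMap ∘ₗ copowerMap J s, copowerMap J r ∘ₗ e.toLinearMap, ?_⟩
    have := copowerMap_comp_id J hrs
    refine LinearMap.ext fun x => ?_
    have h1 := LinearMap.congr_fun this x
    simp only [LinearMap.comp_apply] at h1 ⊢
    rw [← h1]
    exact congrArg _ (e.apply_symm_apply _)
  | succ m ih =>
    obtain ⟨I, C, i, p, hs, hC⟩ := h
    let e := Finsupp.curryLinearEquiv (α := J) (β := I) (M := T) Λ
    exact ⟨J × I, _, _, _, (hs.copower J).comp_equiv
      (Y := FinitisticDimension.copower (J × I) T) e.symm, ih hC⟩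

lemma Cores.hasProjDimLE {m d : ℕ} (h : Cores T m X) (hT : HasProjDimLE Λ d T) :
    HasProjDimLE Λ d X := by
  induction m generalizing X with
  | zero =>
    obtain ⟨I, s, r, hrs⟩ := h
    exact (hasProjDimLE_copower hT I).of_retract hrs
  | succ m ih =>
    obtain ⟨I, C, i, p, hs, hC⟩ := h
    exact hs.hasProjDimLE_left (hasProjDimLE_copower hT I) ((ih hC).mono (by lia))

lemma FinProj.exists_cores [IsNoetherianRing Λ] (hT : FinProj T) (hT' : ExtOrthogonal T)
    (hcog : ∀ X : ModuleCat.{u} Λ, FinProj X →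
      ∃ (ι : Type u) (j : X →ₗ[Λ] copower ι T), Finite ι ∧ Function.Injective j)
    {d : ℕ} (hd : ∀ X : ModuleCat.{u} Λ, FinProj X → HasProjDimLE Λ d X) (hX : FinProj X) :
    Cores T d X := by
  suffices ∀ n, (∀ Z : ModuleCat.{u} Λ, FinProj Z → ∀ j, n < j → ExtVanish j Z X) →
      Cores T n X from this d fun Z hZ j hj => (hd Z hZ).extVanish hj X
  intro n
  induction n generalizing X with
  | zero =>
    intro hext
    obtain ⟨ι, j, _, hj⟩ := hcog X hX
    have hs := isSES_quotient hj
    obtain ⟨r, hr⟩ := hs.extend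
      (hext _ (hs.finProj_right hX (finProj_copower hT ι)) 1 one_pos) LinearMap.id
    exact ⟨ι, j, r, hr⟩
  | succ n ih =>
    intro hext
    obtain ⟨ι, j, _, hj⟩ := hcog X hX
    have hs := isSES_quotient hj
    refine ⟨ι, _, j, _, hs, ih (hs.finProj_right hX (finProj_copower hT ι)) fun Z hZ k hk => ?_⟩
    refine hs.extVanish_right_of_covariant ?_ (hext Z hZ (k + 1) (by lia))
    obtain ⟨k, rfl⟩ : ∃ k', k = k' + 1 := ⟨k - 1, by lia⟩
    exact (extOrthogonal_copower hT' ι).extVanish k hZ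

end Coresolution

section LinearCompactness

lemma exists_linearMap_apply_eq {K V ι : Type*} [Field K] [AddCommGroup V] [Module K V]
    (v : ι → V) (c : ι → K) (h : ∀ s : Finset ι, ∃ f : V →ₗ[K] K, ∀ k ∈ s, f (v k) = c k) :
    ∃ f : V →ₗ[K] K, ∀ k, f (v k) = c k := by
  have hker : Finsupp.linearCombination K c ∈
      LinearMap.range (Finsupp.linearCombination K v).dualMap := by
    rw [LinearMap.range_dualMap_eq_dualAnnihilator_ker, Submodule.mem_dualAnnihilator]
    intro x hx
    obtain ⟨f, hf⟩ := h x.support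
    have hx' := congrArg f (LinearMap.mem_ker.1 hx)
    rw [Finsupp.linearCombination_apply, Finsupp.sum, map_sum, map_zero] at hx'
    rw [Finsupp.linearCombination_apply, Finsupp.sum, ← hx']
    exact Finset.sum_congr rfl fun k hk => by rw [map_smul, hf k hk]
  obtain ⟨f, hf⟩ := hker
  refine ⟨f, fun k => ?_⟩
  have := LinearMap.congr_fun hf (Finsupp.single k 1)
  simpa using this

variable {Λ : Type u} [Ring Λ] {T Y : Type u} [AddCommGroup T] [Module Λ T]
  [AddCommGroup Y] [Module Λ Y]

/-- Systems of linear equations for homomorphisms from direct sums of copies of a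
finite-dimensional module to a finite-dimensional module are solvable if all finite subsystems
are. -/
lemma exists_linearMap_finsupp_apply_eq (K : Type u) [Field K] [Algebra K Λ] [Module K T]
    [IsScalarTower K Λ T] [Module.Finite K T] [Module K Y] [IsScalarTower K Λ Y]
    [Module.Finite K Y] {G J : Type u} (x : G → J →₀ T) (y : G → Y)
    (h : ∀ s : Finset G, ∃ β : (J →₀ T) →ₗ[Λ] Y, ∀ g ∈ s, β (x g) = y g) :
    ∃ β : (J →₀ T) →ₗ[Λ] Y, ∀ g, β (x g) = y g := by
  classical
  have hfin : Module.Finite K (T →ₗ[Λ] Y) :=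
    Module.Finite.of_injective (LinearMap.restrictScalarsₗ K Λ T Y K)
      (LinearMap.restrictScalars_injective K)
  let E (η : Module.Dual K Y) : T →ₗ[K] Module.Dual K (T →ₗ[Λ] Y) :=
    LinearMap.mk₂ K (fun t f => η (f t)) (by simp) (fun c t f => by
      rw [← algebraMap_smul Λ c t, map_smul, algebraMap_smul, map_smul]) (by simp) (by simp)
  let F (b : J → T →ₗ[Λ] Y) : (J →₀ Module.Dual K (T →ₗ[Λ] Y)) →ₗ[K] K :=
    Finsupp.lsum K fun j => Module.Dual.eval K _ (b j)
  have hF : ∀ b η z, F b (Finsupp.mapRange.linearMap (E η) z) = η (Finsupp.lsum ℕ b z) := by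
    intro b η z
    induction z using Finsupp.induction_linear with
    | zero => simp
    | add z z' hz hz' => rw [map_add, map_add, map_add, map_add, hz, hz']
    | single j t =>
      rw [Finsupp.mapRange.linearMap_apply, Finsupp.mapRange_single, Finsupp.lsum_single,
        Finsupp.lsum_single]
      rfl
  have hF_surj : ∀ f, ∃ b, F b = f := by
    intro f
    refine ⟨fun j => (Module.evalEquiv K (T →ₗ[Λ] Y)).symm (f ∘ₗ Finsupp.lsingle j),
      Finsupp.lhom_ext' fun j => LinearMap.ext fun w => ?_⟩
    simp [F]
  obtain ⟨f, hf⟩ := exists_linearMap_apply_eq (K := K)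
    (fun k : G × Module.Dual K Y => Finsupp.mapRange.linearMap (E k.2) (x k.1))
    (fun k => k.2 (y k.1)) fun s => by
      obtain ⟨β, hβ⟩ := h (s.image Prod.fst)
      refine ⟨F fun j => β ∘ₗ Finsupp.lsingle j, fun k hk => ?_⟩
      rw [hF, ← hβ k.1 (Finset.mem_image_of_mem _ hk)]
      congr 2
      exact Finsupp.lhom_ext' fun j => LinearMap.ext fun t => by simp
  obtain ⟨b, rfl⟩ := hF_surj f
  refine ⟨Finsupp.lsum ℕ b, fun g => ?_⟩
  rw [← sub_eq_zero, ← Module.forall_dual_apply_eq_zero_iff K]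
  intro η
  rw [map_sub, ← hF, hf (g, η), sub_self]

/-- The direct sum of copies of a finite-dimensional module splits off the direct product. -/
lemma exists_retraction_pi (K : Type u) [Field K] [Algebra K Λ] [Module K T] [IsScalarTower K Λ T]
    [Module.Finite K T] (I : Type u) :
    ∃ R : (I → T) →ₗ[Λ] (I →₀ T), ∀ x : I →₀ T, R x = x := by
  obtain ⟨ρ, hρ⟩ := (Finsupp.lcoeFun : (I →₀ K) →ₗ[K] I → K).exists_leftInverse_of_injective
    (LinearMap.ker_eq_bot.2 DFunLike.coe_injective)
  let b := Module.Basis.ofVectorSpace K T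
  let R : (I → T) →ₗ[K] (I →₀ T) := ∑ k, Finsupp.mapRange.linearMap
    (LinearMap.toSpanSingleton K T (b k)) ∘ₗ ρ ∘ₗ (b.coord k).compLeft I
  have hR : ∀ (η : T →ₗ[K] K) t k, η (R t k) = ρ (fun k' => η (t k')) k := by
    intro η t k
    have h1 : (fun k' => η (t k')) = ∑ l, η (b l) • (b.coord l).compLeft I t := by
      ext k'
      conv_lhs => rw [← b.sum_repr (t k'), map_sum]
      simp [mul_comm]
    rw [h1, map_sum]
    simp [R, LinearMap.sum_apply, Finsupp.finsetSum_apply, mul_comm]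
  have hext : ∀ t t' : T, (∀ η : T →ₗ[K] K, η t = η t') → t = t' := by
    intro t t' h
    rw [← sub_eq_zero, ← Module.forall_dual_apply_eq_zero_iff K]
    intro η
    rw [map_sub, h, sub_self]
  refine ⟨{ R with map_smul' := fun a t => Finsupp.ext fun k => hext _ _ fun η => ?_ },
    fun x => Finsupp.ext fun k => hext _ _ fun η => ?_⟩
  · let η' : T →ₗ[K] K := η ∘ₗ (Module.toModuleEnd K T a)
    exact (hR η (a • t) k).trans (hR η' t k).symm
  · refine (hR η x k).trans ?_
    have := LinearMap.congr_fun hρ (Finsupp.mapRange.linearMap η x)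
    have h2 := DFunLike.congr_fun this k
    exact h2.trans (by simp)

end LinearCompactness

section Splitting

variable {Λ : Type u} [Ring Λ] {T : ModuleCat.{u} Λ}

lemma ExtOrthogonal.exists_extend_copower (hT : FinProj T) (hT' : ExtOrthogonal T) {I J : Type u}
    {φ : copower I T →ₗ[Λ] copower J T} (hφ : Function.Injective φ) (α : copower I T →ₗ[Λ] T)
    (s : Finset (copower I T)) :
    ∃ β : copower J T →ₗ[Λ] T, ∀ g ∈ s, β (φ g) = α g := by
  classical
  let I' : Finset I := s.biUnion Finsupp.support
  let ι : copower I' T →ₗ[Λ] copower I T := Finsupp.lmapDomain T Λ Subtype.val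
  have hι : Function.Injective ι := Finsupp.mapDomain_injective Subtype.val_injective
  have := hT.1
  have hfp := finProj_copower hT I'
  have := hfp.1
  obtain ⟨J', hJ'⟩ := exists_finset_support_subset (φ ∘ₗ ι)
  let π : copower J T →ₗ[Λ] copower J' T :=
    Finsupp.lcomapDomain (Subtype.val : J' → J) Subtype.val_injective
  have hinj : Function.Injective (π ∘ₗ φ ∘ₗ ι) := by
    rw [injective_iff_map_eq_zero]
    intro x hx
    have hx' : (φ ∘ₗ ι) x = 0 := by
      ext j
      by_cases hj : j ∈ J'
      · exact DFunLike.congr_fun hx ⟨j, hj⟩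
      · exact Finsupp.notMem_support_iff.1 fun h => hj (hJ' x h)
    exact (hφ.comp hι) (hx'.trans (map_zero (φ ∘ₗ ι)).symm)
  have hs := isSES_quotient hinj
  obtain ⟨β, hβ⟩ := hs.extend (hT' _ (hs.finProj_right hfp (finProj_copower hT J'))) (α ∘ₗ ι)
  refine ⟨β ∘ₗ π, fun g hg => ?_⟩
  obtain ⟨g, rfl⟩ : ∃ g', ι g' = g := by
    refine ⟨Finsupp.comapDomain Subtype.val g Subtype.val_injective.injOn, ?_⟩
    refine Finsupp.mapDomain_comapDomain _ Subtype.val_injective _ fun k hk => ?_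
    exact ⟨⟨k, Finset.mem_biUnion.2 ⟨g, hg, hk⟩⟩, rfl⟩
  exact LinearMap.congr_fun hβ g

lemma ExtOrthogonal.exists_retraction_copower (K : Type u) [Field K] [Algebra K Λ]
    [FiniteDimensional K Λ] (hT : FinProj T) (hT' : ExtOrthogonal T) {I J : Type u}
    {φ : copower I T →ₗ[Λ] copower J T} (hφ : Function.Injective φ) :
    ∃ r : copower J T →ₗ[Λ] copower I T, r ∘ₗ φ = LinearMap.id := by
  let : Module K T := Module.compHom T (algebraMap K Λ)
  have : IsScalarTower K Λ T := RestrictScalars.isScalarTower K Λ T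
  have := hT.1
  have : Module.Finite K T := Module.Finite.trans Λ T
  choose β hβ using fun k : I => exists_linearMap_finsupp_apply_eq K φ
    (Finsupp.lapply (R := Λ) k) (hT'.exists_extend_copower hT hφ (Finsupp.lapply k))
  obtain ⟨R, hR⟩ := exists_retraction_pi (Λ := Λ) (T := T) K I
  refine ⟨R ∘ₗ LinearMap.pi β, LinearMap.ext fun x => ?_⟩
  exact (congrArg R (funext fun k => hβ k x)).trans (hR x)

end Splitting

section BigModules

variable {Λ : Type u} [Ring Λ] {A B C T X Y : ModuleCat.{u} Λ} {i : A →ₗ[Λ] B} {p : B →ₗ[Λ] C}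

lemma Cores.of_equiv {m : ℕ} (h : Cores T m X) (e : X ≃ₗ[Λ] Y) : Cores T m Y := by
  cases m with
  | zero =>
    obtain ⟨I, s, r, hrs⟩ := h
    refine ⟨I, s ∘ₗ e.symm.toLinearMap, e.toLinearMap ∘ₗ r, LinearMap.ext fun y => ?_⟩
    have := LinearMap.congr_fun hrs (e.symm y)
    simp only [LinearMap.comp_apply, LinearMap.id_apply] at this
    simp [this]
  | succ m =>
    obtain ⟨I, C, i, p, hs, hC⟩ := h
    refine ⟨I, C, i ∘ₗ e.symm.toLinearMap, p, ⟨hs.inj.comp e.symm.injective, fun y => ?_, hs.surj⟩,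
      hC⟩
    rw [hs.exact]
    constructor
    · rintro ⟨x, rfl⟩
      exact ⟨e x, by simp⟩
    · rintro ⟨x, rfl⟩
      exact ⟨e.symm x, rfl⟩

lemma Cores.of_isSES_of_retract [IsNoetherianRing Λ] (hT : FinProj T) (hT' : ExtOrthogonal T)
    {m : ℕ} (h : IsSES i p) (hB : Cores T 0 B) (hC : Cores T m C) : Cores T (m + 1) A := by
  obtain ⟨I, s, r, hrs⟩ := hB
  have hs := isSES_quotient (i := s) (Function.LeftInverse.injective (LinearMap.congr_fun hrs))
  obtain ⟨t, ht, -⟩ := hs.exists_section hrs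
  obtain ⟨E, j, k, q, hE, -, hks, hgen, -, -, hkj⟩ := hs.exists_pushout p
  have hD : Cores T 0 (ModuleCat.of Λ (_ ⧸ LinearMap.range s)) := ⟨I, t, _, ht⟩
  refine ⟨I, E, s ∘ₗ i, k, ⟨hs.inj.comp h.inj, fun y => ⟨fun hy => ?_, ?_⟩, fun e => ?_⟩,
    Cores.of_isSES hT hT' hE hC (hD.mono (Nat.zero_le m))⟩
  · obtain ⟨z, rfl, hz⟩ := hkj y 0 (by rw [hy, map_zero])
    obtain ⟨x, rfl⟩ := (h.exact z).1 hz
    exact ⟨x, rfl⟩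
  · rintro ⟨x, rfl⟩
    refine (LinearMap.congr_fun hks (i x)).trans ?_
    rw [LinearMap.comp_apply, h.apply_apply_eq_zero, map_zero]
  · obtain ⟨x, y, rfl⟩ := hgen e
    obtain ⟨z, rfl⟩ := h.surj x
    refine ⟨s z + y, ?_⟩
    rw [map_add]
    exact congrArg (· + k y) (LinearMap.congr_fun hks z)

lemma Cores.of_isSES_right (K : Type u) [Field K] [Algebra K Λ] [FiniteDimensional K Λ]
    [IsNoetherianRing Λ] (hT : FinProj T) (hT' : ExtOrthogonal T) {m : ℕ} (h : IsSES i p)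
    (hA : Cores T m A) (hB : Cores T m B) : Cores T (m + 1) C := by
  obtain ⟨I, A', a, a', ha, hA'⟩ := hA.succ
  obtain ⟨E, j, k, q, hE, -, hki, hgen, hdesc, hk, -⟩ := h.exists_pushout a
  obtain ⟨l, hlj, hlk⟩ := hdesc A' a' 0 (by rw [ha.comp_eq_zero, LinearMap.zero_comp])
  have hlj' : ∀ x, l (j x) = a' x := LinearMap.congr_fun hlj
  have hlk' : ∀ x, l (k x) = 0 := LinearMap.congr_fun hlk
  have hE' : IsSES k l := by
    refine ⟨hk ha.inj, fun e => ⟨fun he => ?_, ?_⟩, fun y => ?_⟩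
    · obtain ⟨x, y, rfl⟩ := hgen e
      rw [map_add, hlj', hlk', add_zero] at he
      obtain ⟨n, rfl⟩ := (ha.exact x).1 he
      refine ⟨i n + y, ?_⟩
      rw [map_add]
      exact congrArg (· + k y) (LinearMap.congr_fun hki n)
    · rintro ⟨y, rfl⟩
      exact hlk' y
    · obtain ⟨x, rfl⟩ := ha.surj y
      exact ⟨j x, hlj' x⟩
  obtain ⟨J, E₁, e, e', he, hE₁⟩ := (Cores.of_isSES hT hT' hE' hB hA').succ
  have hej : Function.Injective (e ∘ₗ j) := he.inj.comp hE.inj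
  obtain ⟨r, hr⟩ := hT'.exists_retraction_copower K hT hej
  have hZ := isSES_quotient hej
  obtain ⟨t, ht, -⟩ := hZ.exists_section hr
  have hZ₀ : Cores T 0 (ModuleCat.of Λ (_ ⧸ LinearMap.range (e ∘ₗ j))) := ⟨J, t, _, ht⟩
  obtain ⟨μ, hμ⟩ := hE.exists_desc (Y := ModuleCat.of Λ (_ ⧸ LinearMap.range (e ∘ₗ j)))
    (v := (LinearMap.range (e ∘ₗ j)).mkQ ∘ₗ e) hZ.comp_eq_zero
  obtain ⟨ν, hν⟩ := hZ.exists_desc (v := e') (by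
    rw [← LinearMap.comp_assoc, he.comp_eq_zero, LinearMap.zero_comp])
  have hμ' : ∀ x, μ (q x) = (LinearMap.range (e ∘ₗ j)).mkQ (e x) := LinearMap.congr_fun hμ
  have hν' : ∀ x, ν ((LinearMap.range (e ∘ₗ j)).mkQ x) = e' x := LinearMap.congr_fun hν
  refine Cores.of_isSES_of_retract hT hT' (i := μ) (p := ν) ⟨?_, fun z => ?_, fun y => ?_⟩ hZ₀ hE₁
  · rw [injective_iff_map_eq_zero]
    intro c hc
    obtain ⟨x, rfl⟩ := hE.surj c
    rw [hμ'] at hc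
    obtain ⟨y, hy⟩ := (hZ.exact _).1 hc
    rw [← he.inj hy, hE.apply_apply_eq_zero]
  · obtain ⟨y, rfl⟩ := hZ.surj z
    constructor
    · intro hy
      obtain ⟨x, rfl⟩ := (he.exact y).1 ((hν' y).symm.trans hy)
      exact ⟨q x, hμ' x⟩
    · rintro ⟨c, hc⟩
      obtain ⟨x, rfl⟩ := hE.surj c
      rw [← hc, hμ', hν', he.apply_apply_eq_zero]
  · obtain ⟨x, rfl⟩ := he.surj y
    exact ⟨_, hν' x⟩

lemma exists_cores_prod_of_projective {m : ℕ} (hΛ : Cores T m (ModuleCat.of Λ Λ))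
    (P : ModuleCat.{u} Λ) [Module.Projective Λ P] :
    ∃ Q : ModuleCat.{u} Λ, Module.Projective Λ Q ∧ Cores T m (ModuleCat.of Λ (P × Q)) := by
  let g : (P →₀ Λ) →ₗ[Λ] P := Finsupp.linearCombination Λ id
  obtain ⟨s, hs⟩ := Module.projective_lifting_property g LinearMap.id
    (Finsupp.linearCombination_id_surjective Λ P)
  have hs' : ∀ x, g (s x) = x := LinearMap.congr_fun hs
  let ρ : (P →₀ Λ) →ₗ[Λ] LinearMap.ker g := (LinearMap.id - s ∘ₗ g).codRestrict _ fun x => by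
    simp [hs']
  have hρ : ∀ x, ((ρ x : LinearMap.ker g) : P →₀ Λ) = x - s (g x) := fun x => rfl
  let e : (P →₀ Λ) ≃ₗ[Λ] P × LinearMap.ker g :=
    LinearEquiv.ofLinearMap (g.prod ρ) (s.coprod (LinearMap.ker g).subtype)
      (LinearMap.ext fun x => Prod.ext (by simp [hs']) (Subtype.ext (by simp [hρ, hs'])))
      (LinearMap.ext fun x => by simp [hρ])
  refine ⟨ModuleCat.of Λ (LinearMap.ker g), ?_, (hΛ.copower P).of_equiv e⟩
  exact Module.Projective.of_split (LinearMap.ker g).subtype ρ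
    (LinearMap.ext fun x => Subtype.ext (by simp [hρ]))

lemma _root_.HasProjDimLE.exists_cores_prod (K : Type u) [Field K] [Algebra K Λ]
    [FiniteDimensional K Λ] [IsNoetherianRing Λ] (hT : FinProj T) (hT' : ExtOrthogonal T) {d : ℕ}
    (hΛ : Cores T d (ModuleCat.of Λ Λ)) {n : ℕ} {M : ModuleCat.{u} Λ} (hM : HasProjDimLE Λ n M) :
    ∃ (Q : ModuleCat.{u} Λ) (m : ℕ), Module.Projective Λ Q ∧
      Cores T m (ModuleCat.of Λ (M × Q)) := by
  induction n generalizing M with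
  | zero =>
    have : Module.Projective Λ M := hM
    obtain ⟨Q, hQ, hc⟩ := exists_cores_prod_of_projective hΛ M
    exact ⟨Q, d, hQ, hc⟩
  | succ n ih =>
    obtain ⟨P, g, hP, hg, hker⟩ := hM
    obtain ⟨Q, m, hQ, hN⟩ := ih hker
    have : Module.Projective Λ (ModuleCat.of Λ (P × Q)) :=
      inferInstanceAs (Module.Projective Λ (P × Q))
    obtain ⟨Q', hQ', hP'⟩ := exists_cores_prod_of_projective hΛ (ModuleCat.of Λ (P × Q))
    let a : ModuleCat.of Λ (LinearMap.ker g × Q) →ₗ[Λ] ModuleCat.of Λ ((P × Q) × Q') :=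
      LinearMap.inl Λ (P × Q) Q' ∘ₗ (LinearMap.ker g).subtype.prodMap LinearMap.id
    let b : ModuleCat.of Λ ((P × Q) × Q') →ₗ[Λ] ModuleCat.of Λ (M × Q') :=
      (g ∘ₗ LinearMap.fst Λ P Q).prodMap LinearMap.id
    have hab : IsSES a b := by
      refine ⟨?_, ?_, ?_⟩
      · rintro ⟨x, y⟩ ⟨x', y'⟩ h
        have h1 : (x : P) = x' := congrArg (fun z => z.1.1) h
        have h2 : y = y' := congrArg (fun z => z.1.2) h
        exact Prod.ext (Subtype.ext h1) h2
      · rintro ⟨⟨x, y⟩, z⟩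
        constructor
        · intro h
          have h1 : g x = 0 := congrArg Prod.fst h
          have h2 : z = 0 := congrArg Prod.snd h
          exact ⟨(⟨x, h1⟩, y), by rw [h2]; rfl⟩
        · rintro ⟨⟨x', y'⟩, h⟩
          rw [← h]
          exact Prod.ext x'.2 rfl
      · rintro ⟨x, z⟩
        obtain ⟨x, rfl⟩ := hg x
        exact ⟨((x, 0), z), rfl⟩
    exact ⟨Q', max m d + 1, hQ', Cores.of_isSES_right K hT hT' hab (hN.mono (le_max_left m d))
      (hP'.mono (le_max_right m d))⟩

lemma hasProjDimLE_of_hasFinProjDim (K : Type u) [Field K] [Algebra K Λ]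
    [FiniteDimensional K Λ] (hcf : ContravariantlyFinite Λ) {d : ℕ}
    (hd : ∀ S : ModuleCat.{u} Λ, IsSimpleModule Λ S → HasSpecialApprox d S)
    {M : ModuleCat.{u} Λ} (hM : HasFinProjDim Λ M) : HasProjDimLE Λ d M := by
  have : IsArtinianRing Λ := IsArtinianRing.of_finite K Λ
  have hfin : ∀ X : ModuleCat.{u} Λ, FinProj X → HasProjDimLE Λ d X := fun X hX => by
    have := hX.1
    exact (hasSpecialApprox_of_isFiniteLength hd X
      (isFiniteLength_iff_isNoetherian_isArtinian.2 ⟨inferInstance, inferInstance⟩)).hasProjDimLE hX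
  obtain ⟨T, hT, hT', hcog⟩ := exists_relative_injective_cogenerator K hcf
  have hΛ : FinProj (ModuleCat.of Λ Λ) :=
    finProj_of_projective (h := inferInstanceAs (Module.Projective Λ Λ))
  obtain ⟨n, hn⟩ := hM
  obtain ⟨Q, m, -, hc⟩ := hn.exists_cores_prod K hT hT' (hT.exists_cores hT' hcog hfin hΛ)
  exact (hc.hasProjDimLE (hfin T hT)).of_retract (s := LinearMap.inl Λ M Q)
    (r := LinearMap.fst Λ M Q) (LinearMap.fst_comp_inl ..)

end BigModules

end FinitisticDimension

open FinitisticDimension in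
/-- Suppose `P^∞(Λ-mod)` is contravariantly finite in `Λ-mod`, and for each
simple left `Λ`-module `S` let `A S` (with map `f S : A S → S`) be a right
`P^∞(Λ-mod)`-approximation of `S` of minimal `K`-dimension among all right
`P^∞(Λ-mod)`-approximations of `S`.  Then
`l.findim Λ = l.Findim Λ = sup_{S simple} projdim (A S)`; in particular `l.Findim Λ` is
finite. -/
theorem findim_eq_FinDim_eq_sup_of_contravariantlyFinite
    (K : Type u) (Λ : Type u) [Field K] [Ring Λ] [Algebra K Λ] [FiniteDimensional K Λ]
    (hcf : ContravariantlyFinite Λ)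
    (A : ModuleCat.{u} Λ → ModuleCat.{u} Λ)
    (f : ∀ S : ModuleCat.{u} Λ, A S →ₗ[Λ] S)
    (happrox : ∀ S : ModuleCat.{u} Λ, IsSimpleModule Λ S → IsRightApprox Λ S (A S) (f S))
    (hmin : ∀ S : ModuleCat.{u} Λ, IsSimpleModule Λ S →
      ∀ (A' : ModuleCat.{u} Λ) (f' : A' →ₗ[Λ] S), IsRightApprox Λ S A' f' →
        Module.finrank K (RestrictScalars K Λ (A S)) ≤
          Module.finrank K (RestrictScalars K Λ A')) :
    finDimLittle Λ = finDimBig Λ ∧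
      finDimBig Λ = (⨆ (S : ModuleCat.{u} Λ) (_ : IsSimpleModule Λ S), projDim Λ (A S)) ∧
      finDimBig Λ ≠ ⊤ := by
  have : IsArtinianRing Λ := IsArtinianRing.of_finite K Λ
  have hminApprox : ∀ S : ModuleCat.{u} Λ, IsSimpleModule Λ S → IsMinApprox (f S) :=
    fun S hS => isMinApprox_of_finrank K (happrox S hS) (hmin S hS)
  obtain ⟨n, hn⟩ := exists_bound_of_isMinApprox K hcf
  have hle : (⨆ (S : ModuleCat.{u} Λ) (_ : IsSimpleModule Λ S), projDim Λ (A S)) ≤ (n : ℕ∞) :=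
    iSup₂_le fun S hS => projDim_le_iff.2 (hn S (A S) (f S) hS (hminApprox S hS))
  obtain ⟨d, hd⟩ := ENat.ne_top_iff_exists.1 (ne_top_of_le_ne_top (ENat.natCast_ne_top n) hle)
  have hbig : finDimBig Λ ≤ (d : ℕ∞) := iSup₂_le fun M hM =>
    projDim_le_iff.2 <| hasProjDimLE_of_hasFinProjDim K hcf (fun S hS => by
      exact (hminApprox S hS).hasSpecialApprox <| projDim_le_iff.1 <|
        hd ▸ le_iSup₂ (f := fun (S : ModuleCat.{u} Λ) (_ : IsSimpleModule Λ S) =>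
          projDim Λ (A S)) S hS) hM
  have hlittle : finDimLittle Λ ≤ finDimBig Λ := iSup₂_le fun M hM =>
    le_iSup₂ (f := fun (M : ModuleCat.{u} Λ) (_ : HasFinProjDim Λ M) => projDim Λ M) M hM.2
  have hsup : (d : ℕ∞) ≤ finDimLittle Λ := hd ▸ iSup₂_le fun S hS =>
    le_iSup₂ (f := fun (M : ModuleCat.{u} Λ) (_ : Module.Finite Λ M ∧ HasFinProjDim Λ M) =>
      projDim Λ M) (A S) (happrox S hS).finProj
  exact ⟨hlittle.antisymm (hbig.trans hsup), hd ▸ hbig.antisymm (hsup.trans hlittle),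
    ne_top_of_le_ne_top (ENat.natCast_ne_top d) hbig⟩
end

section
/- Let K be a field and Λ a finite-dimensional associative unital K-algebra. If every simple left Λ-module admits a right P^∞(Λ-mod)-approximation, then P^∞(Λ-mod) is contravariantly finite in Λ-mod, i.e. every finitely generated left Λ-module admits a right P^∞(Λ-mod)-approximation. -/
universe u

section Approximation

open CategoryTheory

variable {Λ : Type u} [Ring Λ]

theorem hasProjDimLE_iff (n : ℕ) (M : ModuleCat.{u} Λ) :
    HasProjDimLE Λ n M ↔ HasProjectiveDimensionLE M n := by
  induction n generalizing M with
  | zero =>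
    rw [← projective_iff_hasProjectiveDimensionLE_zero]
    exact IsProjective.iff_projective M
  | succ n ih =>
    constructor
    · rintro ⟨P, g, hP, hg, hker⟩
      have hP' : Projective P := (IsProjective.iff_projective P).1 hP
      exact ((LinearMap.shortExact_shortComplexKer hg).hasProjectiveDimensionLT_X₃_iff n hP').2
        ((ih _).1 hker)
    · intro h
      have hS := M.shortExact_projectiveShortComplex
      have hP : Module.Projective Λ M.projectiveShortComplex.X₂ := inferInstance
      exact ⟨_, M.projectiveShortComplex.g.hom, hP,
        (ModuleCat.epi_iff_surjective _).1 hS.epi_g,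
        (ih _).2 ((hS.hasProjectiveDimensionLT_X₃_iff n
          ((IsProjective.iff_projective _).1 hP)).1 h)⟩

variable {A B C E L M N P : Type u}
  [AddCommGroup A] [Module Λ A] [AddCommGroup B] [Module Λ B] [AddCommGroup C] [Module Λ C]
  [AddCommGroup E] [Module Λ E] [AddCommGroup L] [Module Λ L] [AddCommGroup M] [Module Λ M]
  [AddCommGroup N] [Module Λ N] [AddCommGroup P] [Module Λ P]

theorem HasFinProjDim.of_retract (i : B →ₗ[Λ] A) (r : A →ₗ[Λ] B) (hri : r ∘ₗ i = LinearMap.id)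
    (hA : HasFinProjDim Λ (ModuleCat.of Λ A)) : HasFinProjDim Λ (ModuleCat.of Λ B) := by
  obtain ⟨n, hn⟩ := hA
  rw [hasProjDimLE_iff] at hn
  let ret : Retract (ModuleCat.of Λ B) (ModuleCat.of Λ A) :=
    { i := ModuleCat.ofHom i
      r := ModuleCat.ofHom r
      retract := by rw [← ModuleCat.ofHom_comp, hri]; rfl }
  exact ⟨n, (hasProjDimLE_iff _ _).2 (ret.hasProjectiveDimensionLT _)⟩

theorem HasFinProjDim.ker_of_projective [Module.Projective Λ P] (p : P →ₗ[Λ] B)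
    (hp : Function.Surjective p) (hB : HasFinProjDim Λ (ModuleCat.of Λ B)) :
    HasFinProjDim Λ (ModuleCat.of Λ (LinearMap.ker p)) := by
  obtain ⟨n, hn⟩ := hB
  rw [hasProjDimLE_iff] at hn
  have hn' : HasProjectiveDimensionLT (ModuleCat.of Λ B) (n + 2) :=
    hasProjectiveDimensionLT_of_ge _ (n + 1) _ (by lia)
  exact ⟨n, (hasProjDimLE_iff _ _).2
    (((LinearMap.shortExact_shortComplexKer hp).hasProjectiveDimensionLT_X₃_iff n
      ((IsProjective.iff_projective P).1 ‹_›)).1 hn')⟩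

theorem HasFinProjDim.of_extension (i : A →ₗ[Λ] E) (p : E →ₗ[Λ] B)
    (hip : Function.Exact i p) (hi : Function.Injective i) (hp : Function.Surjective p)
    (hA : HasFinProjDim Λ (ModuleCat.of Λ A)) (hB : HasFinProjDim Λ (ModuleCat.of Λ B)) :
    HasFinProjDim Λ (ModuleCat.of Λ E) := by
  obtain ⟨m, hm⟩ := hA
  obtain ⟨n, hn⟩ := hB
  rw [hasProjDimLE_iff] at hm hn
  refine ⟨max m n, (hasProjDimLE_iff _ _).2 ?_⟩
  exact (ModuleCat.shortComplex_shortExact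
      (ModuleCat.shortComplexOfCompEqZero i p hip.linearMap_comp_eq_zero)
      hip hi hp).hasProjectiveDimensionLT_X₂ (max m n + 1)
    (hasProjectiveDimensionLT_of_ge _ (m + 1) _ (by lia))
    (hasProjectiveDimensionLT_of_ge _ (n + 1) _ (by lia))

/-- The pushout of an extension `0 → ker p → E → B → 0` along a map `u : ker p → A`. -/
theorem exists_pushout_extension (p : E →ₗ[Λ] B) (hp : Function.Surjective p)
    (u : LinearMap.ker p →ₗ[Λ] A) :
    ∃ (X : ModuleCat.{u} Λ) (i : A →ₗ[Λ] X) (j : E →ₗ[Λ] X) (q : X →ₗ[Λ] B),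
      Function.Injective i ∧ Function.Exact i q ∧ Function.Surjective q ∧
      (∀ x : LinearMap.ker p, i (u x) = j x) ∧ (∀ e, q (j e) = p e) ∧
      (∀ x, ∃ a e, i a + j e = x) ∧
      (Module.Finite Λ A → Module.Finite Λ E → Module.Finite Λ X) ∧
      ∀ (T : ModuleCat.{u} Λ) (f : A →ₗ[Λ] T) (g : E →ₗ[Λ] T),
        (∀ x : LinearMap.ker p, f (u x) = g x) →
          ∃ k : X →ₗ[Λ] T, (∀ a, k (i a) = f a) ∧ ∀ e, k (j e) = g e := by
  let W : Submodule Λ (A × E) := LinearMap.range (u.prod (-(LinearMap.ker p).subtype))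
  let i : A →ₗ[Λ] (A × E) ⧸ W := W.mkQ ∘ₗ LinearMap.inl Λ A E
  let j : E →ₗ[Λ] (A × E) ⧸ W := W.mkQ ∘ₗ LinearMap.inr Λ A E
  have desc : ∀ (T : ModuleCat.{u} Λ) (f : A →ₗ[Λ] T) (g : E →ₗ[Λ] T),
      (∀ x : LinearMap.ker p, f (u x) = g x) →
        ∃ k : (A × E) ⧸ W →ₗ[Λ] T, (∀ a, k (i a) = f a) ∧ ∀ e, k (j e) = g e := by
    intro T f g hfg
    refine ⟨W.liftQ (f.coprod g) ?_, fun a => ?_, fun e => ?_⟩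
    · rintro _ ⟨x, rfl⟩
      simp [hfg]
    · simp [i]
    · simp [j]
  have hij : ∀ x : LinearMap.ker p, i (u x) = j x := by
    intro x
    refine (Submodule.Quotient.eq W).2 ⟨x, ?_⟩
    ext <;> simp
  have hsum : ∀ x, ∃ a e, i a + j e = x := by
    intro x
    obtain ⟨⟨a, e⟩, rfl⟩ := W.mkQ_surjective x
    exact ⟨a, e, by simp [i, j, ← Submodule.Quotient.mk_add]⟩
  obtain ⟨q, hqi, hqj⟩ := desc (ModuleCat.of Λ B) 0 p (fun x => by simp)
  refine ⟨ModuleCat.of Λ ((A × E) ⧸ W), i, j, q, ?_, ?_, ?_, hij, hqj, hsum, ?_, desc⟩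
  · rw [← LinearMap.ker_eq_bot, LinearMap.ker_eq_bot']
    intro a ha
    obtain ⟨x, hx⟩ := (Submodule.Quotient.mk_eq_zero W).1 ha
    have h1 : u x = a := congrArg Prod.fst hx
    have h2 : -(x : E) = 0 := congrArg Prod.snd hx
    have h3 : x = 0 := Subtype.ext (neg_eq_zero.1 h2)
    rw [← h1, h3, map_zero]
  · intro x
    constructor
    · intro hx
      obtain ⟨a, e, rfl⟩ := hsum x
      have he : p e = 0 := by
        rw [map_add, hqi, hqj] at hx
        simpa using hx
      exact ⟨a + u ⟨e, he⟩, by rw [map_add, hij]⟩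
    · rintro ⟨a, rfl⟩
      simp [hqi]
  · intro b
    obtain ⟨e, rfl⟩ := hp b
    exact ⟨j e, hqj e⟩
  · intro _ _
    exact inferInstanceAs (Module.Finite Λ ((A × E) ⧸ W))

/-- A right approximation whose kernel `Y` satisfies `Ext¹(B, Y) = 0` for all finitely generated
`B` of finite projective dimension, phrased as an extension property of maps into `Y`. -/
def IsSpecialRightApprox (f : A →ₗ[Λ] M) : Prop :=
  IsRightApprox Λ (ModuleCat.of Λ M) (ModuleCat.of Λ A) f ∧
    ∀ (E B : ModuleCat.{u} Λ) (p : E →ₗ[Λ] B), Function.Surjective p → Module.Finite Λ E →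
      HasFinProjDim Λ B → ∀ u : LinearMap.ker p →ₗ[Λ] A, f ∘ₗ u = 0 →
        ∃ v : E →ₗ[Λ] A, f ∘ₗ v = 0 ∧ ∀ x : LinearMap.ker p, v x = u x

/-- **Wakamatsu's lemma**. -/
theorem IsRightApprox.isSpecial_of_minimal {f : A →ₗ[Λ] M}
    (hf : IsRightApprox Λ (ModuleCat.of Λ M) (ModuleCat.of Λ A) f)
    (hmin : ∀ h : A →ₗ[Λ] A, f ∘ₗ h = f → Function.Bijective h) :
    IsSpecialRightApprox f := by
  refine ⟨hf, fun E B p hp hE hB u hu => ?_⟩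
  obtain ⟨X, i, j, q, hi, hiq, hq, hij, -, -, hfin, desc⟩ := exists_pushout_extension p hp u
  obtain ⟨k, hki, hkj⟩ := desc (ModuleCat.of Λ M) f 0 (fun x => LinearMap.congr_fun hu x)
  obtain ⟨l, hl⟩ := hf.2.2 X (hfin hf.1 hE) (HasFinProjDim.of_extension i q hiq hi hq hf.2.1 hB) k
  have hfl (x : X) : f (l x) = k x := LinearMap.congr_fun hl x
  let e : A ≃ₗ[Λ] A := LinearEquiv.ofBijective (l ∘ₗ i) (hmin _ (by ext a; simp [hfl, hki]))
  have he (a : A) : f (e a) = f a := by simp [e, hfl, hki]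
  have he' (a : A) : f (e.symm a) = f a := by rw [← he, e.apply_symm_apply]
  refine ⟨e.symm.toLinearMap ∘ₗ l ∘ₗ j, ?_, fun x => ?_⟩
  · ext x
    simp [he', hfl, hkj]
  · simp only [LinearMap.comp_apply, LinearEquiv.coe_coe]
    rw [← hij, LinearEquiv.symm_apply_eq]
    rfl

theorem IsRightApprox.exists_isSpecial [IsArtinianRing Λ] [IsNoetherianRing Λ]
    {f : A →ₗ[Λ] M} (hf : IsRightApprox Λ (ModuleCat.of Λ M) (ModuleCat.of Λ A) f) :
    ∃ (A' : ModuleCat.{u} Λ) (f' : A' →ₗ[Λ] M), IsSpecialRightApprox f' := by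
  obtain ⟨X, ⟨g, hg⟩, hX⟩ := (InvImage.wf (fun X : ModuleCat.{u} Λ => Module.length Λ X)
    wellFounded_lt).has_min {X | ∃ g : X →ₗ[Λ] M, IsRightApprox Λ (ModuleCat.of Λ M) X g}
    ⟨ModuleCat.of Λ A, f, hf⟩
  have := hg.1
  refine ⟨X, g, hg.isSpecial_of_minimal fun h hgh => ?_⟩
  obtain ⟨n, hn, hn1⟩ :=
    ((LinearMap.eventually_isCompl_ker_pow_range_pow h).and (Filter.eventually_ge_atTop 1)).exists
  have hgn : ∀ m x, g ((h ^ m) x) = g x := by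
    intro m
    induction m with
    | zero => simp
    | succ m ih =>
      intro x
      rw [pow_succ, Module.End.mul_apply, ih]
      exact LinearMap.congr_fun hgh x
  have hR : IsRightApprox Λ (ModuleCat.of Λ M) (ModuleCat.of Λ (LinearMap.range (h ^ n)))
      (g ∘ₗ (LinearMap.range (h ^ n)).subtype) := by
    refine ⟨inferInstanceAs (Module.Finite Λ (LinearMap.range (h ^ n))),
      HasFinProjDim.of_retract (LinearMap.range (h ^ n)).subtype (Submodule.projectionOnto _ _ hn.symm)
        (by ext; simp) hg.2.1, fun B hB hB' b => ?_⟩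
    obtain ⟨t, ht⟩ := hg.2.2 B hB hB' b
    refine ⟨(h ^ n).rangeRestrict ∘ₗ t, ?_⟩
    ext x
    exact (hgn n (t x)).trans (LinearMap.congr_fun ht x)
  have htop : LinearMap.range (h ^ n) = ⊤ := by
    by_contra hne
    exact hX _ ⟨_, hR⟩ (Submodule.length_lt hne)
  have hsurj : Function.Surjective h := by
    intro x
    obtain ⟨y, rfl⟩ := LinearMap.range_eq_top.1 htop x
    obtain ⟨m, rfl⟩ := Nat.exists_eq_add_of_le' hn1
    exact ⟨(h ^ m) y, by rw [pow_succ', Module.End.mul_apply]⟩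
  exact ⟨IsNoetherian.injective_of_surjective_endomorphism h hsurj, hsurj⟩

theorem IsRightApprox.surjective_s4 [Module.Finite Λ M] {f : A →ₗ[Λ] M}
    (hf : IsRightApprox Λ (ModuleCat.of Λ M) (ModuleCat.of Λ A) f) : Function.Surjective f := by
  obtain ⟨n, g, hg⟩ := Module.Finite.exists_fin' Λ M
  obtain ⟨h, rfl⟩ := hf.2.2 (ModuleCat.of Λ (Fin n → Λ))
    (inferInstanceAs (Module.Finite Λ (Fin n → Λ)))
    ⟨0, inferInstanceAs (Module.Projective Λ (Fin n → Λ))⟩ g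
  exact Function.Surjective.of_comp hg

/-- A horseshoe lemma: right approximations of the ends of a short exact sequence `0 → L → M → N → 0`
yield one of `M`, provided the one of `L` is special. -/
theorem IsSpecialRightApprox.exists_extension {a : A →ₗ[Λ] L} {c : C →ₗ[Λ] N}
    (ha : IsSpecialRightApprox a)
    (hc : IsRightApprox Λ (ModuleCat.of Λ N) (ModuleCat.of Λ C) c)
    [Module.Finite Λ L] [IsNoetherianRing Λ] (l : L →ₗ[Λ] M) (π : M →ₗ[Λ] N)
    (hl : Function.Injective l) (hlπ : Function.Exact l π) (hπ : Function.Surjective π) :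
    ∃ (X : ModuleCat.{u} Λ) (k : X →ₗ[Λ] M), IsRightApprox Λ (ModuleCat.of Λ M) X k := by
  have : Module.Finite Λ C := hc.1
  have hasurj : Function.Surjective a := ha.1.surjective_s4
  obtain ⟨n, p, hp⟩ := Module.Finite.exists_fin' Λ C
  obtain ⟨s, hs⟩ := Module.projective_lifting_property π (c ∘ₗ p) hπ
  have hs (x) : π (s x) = c (p x) := LinearMap.congr_fun hs x
  let w : LinearMap.ker p →ₗ[Λ] L := (LinearEquiv.ofInjective l hl).symm.toLinearMap ∘ₗ
    (s ∘ₗ (LinearMap.ker p).subtype).codRestrict (LinearMap.range l)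
      fun x => (hlπ _).1 (by simp [hs])
  have hw (x : LinearMap.ker p) : l (w x) = s x :=
    congrArg Subtype.val ((LinearEquiv.ofInjective l hl).apply_symm_apply _)
  obtain ⟨φ, hφ⟩ := ha.1.2.2 (ModuleCat.of Λ (LinearMap.ker p))
    (inferInstanceAs (Module.Finite Λ (LinearMap.ker p)))
    (HasFinProjDim.ker_of_projective p hp hc.2.1) w
  have hφ (x : LinearMap.ker p) : a (φ x) = w x := LinearMap.congr_fun hφ x
  obtain ⟨X, i, j, q, hi, hiq, hq, -, hqj, hsum, hfin, desc⟩ := exists_pushout_extension p hp φ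
  obtain ⟨k, hki, hkj⟩ := desc (ModuleCat.of Λ M) (l ∘ₗ a) s (fun x => by simp [hφ, hw])
  have hπk (x : X) : π (k x) = c (q x) := by
    obtain ⟨y, e, rfl⟩ := hsum x
    simp [hki, hkj, hqj, hs, hiq.apply_apply_eq_zero, hlπ.apply_apply_eq_zero]
  have hXfin : Module.Finite Λ X := hfin ha.1.1 inferInstance
  refine ⟨X, k, hXfin,
    HasFinProjDim.of_extension i q hiq hi hq ha.1.2.1 hc.2.1, fun B hB hB' g => ?_⟩
  obtain ⟨t, ht⟩ := hc.2.2 B hB hB' (π ∘ₗ g)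
  have ht (b : B) : c (t b) = π (g b) := LinearMap.congr_fun ht b
  -- `F` is the fibre product of `B` and `X` over `C ×_N M`; it is an extension of `B` by `ker a`.
  let F : Submodule Λ (B × X) :=
    LinearMap.eqLocus (t.coprod 0) ((0 : B →ₗ[Λ] C).coprod q) ⊓
      LinearMap.eqLocus (g.coprod 0) ((0 : B →ₗ[Λ] M).coprod k)
  have hF (b : B) (x : X) : (b, x) ∈ F ↔ t b = q x ∧ g b = k x := by
    simp [F]
  let r : F →ₗ[Λ] B := LinearMap.fst Λ B X ∘ₗ F.subtype
  let y : F →ₗ[Λ] X := LinearMap.snd Λ B X ∘ₗ F.subtype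
  have hty (z : F) : t (r z) = q (y z) := ((hF _ _).1 z.2).1
  have hgy (z : F) : g (r z) = k (y z) := ((hF _ _).1 z.2).2
  have hr : Function.Surjective r := by
    intro b
    obtain ⟨x, hx⟩ := hq (t b)
    obtain ⟨m, hm⟩ := (hlπ (k x - g b)).1 (by rw [map_sub, hπk, hx, ht, sub_self])
    obtain ⟨m, rfl⟩ := hasurj m
    refine ⟨⟨(b, x - i m), (hF _ _).2 ⟨?_, ?_⟩⟩, rfl⟩
    · simp [hx, hiq.apply_apply_eq_zero]
    · simp [hki, hm]
  let u : LinearMap.ker r →ₗ[Λ] A := (LinearEquiv.ofInjective i hi).symm.toLinearMap ∘ₗ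
    (y ∘ₗ (LinearMap.ker r).subtype).codRestrict (LinearMap.range i)
      fun z => (hiq _).1 (by simp [← hty])
  have hu (z : LinearMap.ker r) : i (u z) = y z :=
    congrArg Subtype.val ((LinearEquiv.ofInjective i hi).apply_symm_apply _)
  obtain ⟨v, hav, hvu⟩ := ha.2 (ModuleCat.of Λ F) B r hr
    (inferInstanceAs (Module.Finite Λ F)) hB' u (by
      ext z
      apply hl
      have h0 : l (a (u z)) = k (i (u z)) := (hki _).symm
      simp [h0, hu, ← hgy])
  have hker : LinearMap.ker r ≤ LinearMap.ker (y - i ∘ₗ v) := by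
    intro z hz
    have h1 := hvu ⟨z, hz⟩
    have h2 := hu ⟨z, hz⟩
    simp only at h1 h2
    simp [h1, h2]
  let e := r.quotKerEquivOfSurjective hr
  refine ⟨(LinearMap.ker r).liftQ (y - i ∘ₗ v) hker ∘ₗ e.symm.toLinearMap, ?_⟩
  ext b
  obtain ⟨z, rfl⟩ := hr b
  have he : e.symm (r z) = (LinearMap.ker r).mkQ z := by
    rw [LinearEquiv.symm_apply_eq]
    rfl
  have hvz : a (v z) = 0 := LinearMap.congr_fun hav z
  simp [he, hgy, hki, hvz]

theorem exists_isRightApprox_of_simples [IsArtinianRing Λ] [IsNoetherianRing Λ]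
    (h : ∀ S : ModuleCat.{u} Λ, IsSimpleModule Λ S →
      ∃ (A : ModuleCat.{u} Λ) (f : A →ₗ[Λ] S), IsRightApprox Λ S A f)
    [Module.Finite Λ M] (I : Submodule Λ M) :
    ∃ (A : ModuleCat.{u} Λ) (f : A →ₗ[Λ] M ⧸ I),
      IsRightApprox Λ (ModuleCat.of Λ (M ⧸ I)) A f := by
  induction I using IsNoetherian.induction with
  | hgt I ih =>
  by_cases hI : I = ⊤
  · subst hI
    refine ⟨ModuleCat.of Λ PUnit.{u + 1}, 0, inferInstanceAs (Module.Finite Λ PUnit.{u + 1}),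
      ⟨0, inferInstanceAs (Module.Projective Λ PUnit.{u + 1})⟩, fun B _ _ g => ⟨0, ?_⟩⟩
    ext
    exact Subsingleton.elim _ _
  · obtain ⟨J, hIJ, -⟩ := exists_covBy_le_of_lt (lt_top_iff_ne_top.2 hI)
    obtain ⟨C, c, hc⟩ := ih J hIJ.lt
    have hS := (covBy_iff_quot_is_simple hIJ.le).1 hIJ
    obtain ⟨A₀, a₀, ha₀⟩ := h (ModuleCat.of Λ (J ⧸ I.comap J.subtype)) hS
    obtain ⟨A, a, ha⟩ := IsRightApprox.exists_isSpecial ha₀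
    refine ha.exists_extension hc ((I.comap J.subtype).mapQ I J.subtype le_rfl)
      (Submodule.factor hIJ.le) ?_ ?_ (Submodule.factor_surjective hIJ.le)
    · rw [← LinearMap.ker_eq_bot, Submodule.ker_mapQ, Submodule.mkQ_map_self]
    · rw [LinearMap.exact_iff, Submodule.range_mapQ, Submodule.range_subtype, Submodule.factor,
        Submodule.ker_mapQ, Submodule.comap_id]

end Approximation

/-- Auslander–Reiten.  If every simple left `Λ`-module admits a right
`P^∞(Λ-mod)`-approximation, then `P^∞(Λ-mod)` is contravariantly finite in `Λ-mod`, i.e.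
every finitely generated left `Λ`-module admits a right `P^∞(Λ-mod)`-approximation. -/
theorem contravariantlyFinite_of_simples_have_rightApprox
    (K : Type u) (Λ : Type u) [Field K] [Ring Λ] [Algebra K Λ] [FiniteDimensional K Λ]
    (h : ∀ S : ModuleCat.{u} Λ, IsSimpleModule Λ S →
      ∃ (A : ModuleCat.{u} Λ) (f : A →ₗ[Λ] S), IsRightApprox Λ S A f) :
    ContravariantlyFinite Λ := by
  have : IsArtinianRing Λ := IsArtinianRing.of_finite K Λ
  have : IsNoetherianRing Λ := IsNoetherianRing.of_finite K Λ
  intro M hM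
  obtain ⟨A, f, hA, hA', hf⟩ := exists_isRightApprox_of_simples h (⊥ : Submodule Λ M)
  let e := Submodule.quotEquivOfEqBot (⊥ : Submodule Λ M) rfl
  refine ⟨A, e.toLinearMap ∘ₗ f, hA, hA', fun B hB hB' g => ?_⟩
  obtain ⟨t, ht⟩ := hf B hB hB' (e.symm.toLinearMap ∘ₗ g)
  refine ⟨t, ?_⟩
  rw [LinearMap.comp_assoc, ht]
  ext b
  simp
end

section
/- Let K be a field and Λ a finite-dimensional associative unital K-algebra. Then any direct product of a family of left Λ-modules each having projective dimension at most 1 again has projective dimension at most 1 as a left Λ-module. -/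
universe u

open TensorProduct in
/-- The canonical map `A ⊗[K] ∏ i, M i → ∏ i, A ⊗[K] M i`, linear over the (possibly
noncommutative) `K`-algebra `A`. -/
noncomputable def tensorPiHom (K A : Type*) [CommRing K] [Ring A] [Algebra K A]
    {ι : Type*} (M : ι → Type*) [∀ i, AddCommGroup (M i)] [∀ i, Module K (M i)] :
    A ⊗[K] (∀ i, M i) →ₗ[A] ∀ i, A ⊗[K] M i :=
  LinearMap.pi fun i =>
    AlgebraTensorModule.map (LinearMap.id : A →ₗ[A] A) (LinearMap.proj i : (∀ i, M i) →ₗ[K] M i)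

open TensorProduct in
theorem equivFinsuppOfBasisLeft_tensorPiHom {K A κ ι : Type*} [CommRing K] [Ring A]
    [Algebra K A] [DecidableEq κ] (b : Module.Basis κ K A)
    (M : ι → Type*) [∀ i, AddCommGroup (M i)] [∀ i, Module K (M i)]
    (x : A ⊗[K] (∀ i, M i)) (i : ι) (k : κ) :
    equivFinsuppOfBasisLeft b (tensorPiHom K A M x i) k = equivFinsuppOfBasisLeft b x k i := by
  induction x using TensorProduct.induction_on with
  | zero => simp
  | tmul a m => simp [tensorPiHom]
  | add x y hx hy => simp [hx, hy]

theorem tensorPiHom_bijective (K A : Type*) [CommRing K] [Ring A] [Algebra K A]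
    [Module.Free K A] [Module.Finite K A] {ι : Type*} (M : ι → Type*)
    [∀ i, AddCommGroup (M i)] [∀ i, Module K (M i)] :
    Function.Bijective (tensorPiHom K A M) := by
  classical
  let b := Module.Free.chooseBasis K A
  constructor
  · intro x y hxy
    apply (TensorProduct.equivFinsuppOfBasisLeft b).injective
    ext k i
    rw [← equivFinsuppOfBasisLeft_tensorPiHom, hxy, equivFinsuppOfBasisLeft_tensorPiHom]
  · intro y
    refine ⟨(TensorProduct.equivFinsuppOfBasisLeft b).symm (Finsupp.equivFunOnFinite.symm
      fun k i => TensorProduct.equivFinsuppOfBasisLeft b (y i) k), ?_⟩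
    funext i
    apply (TensorProduct.equivFinsuppOfBasisLeft b).injective
    ext k
    rw [equivFinsuppOfBasisLeft_tensorPiHom, LinearEquiv.apply_symm_apply]
    rfl

open TensorProduct in
/-- Over a finite-dimensional algebra, products of projective modules are projective. -/
theorem projective_pi_of_finiteDimensional (K A : Type*) [Field K] [Ring A] [Algebra K A]
    [FiniteDimensional K A] {ι : Type*} (P : ι → Type*) [∀ i, AddCommGroup (P i)]
    [∀ i, Module A (P i)] (hP : ∀ i, Module.Projective A (P i)) :
    Module.Projective A (∀ i, P i) := by
  let (i : ι) : Module K (P i) := Module.compHom (P i) (algebraMap K A)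
  have (i : ι) : IsScalarTower K A (P i) := .of_algebraMap_smul fun _ _ => rfl
  let act (i : ι) : A →ₗ[A] P i →ₗ[K] P i :=
    { toFun := fun a => Algebra.lsmul K K (P i) a
      map_add' := fun a b => map_add _ a b
      map_smul' := fun a b => by ext x; exact mul_smul a b x }
  let μ (i : ι) : A ⊗[K] P i →ₗ[A] P i := AlgebraTensorModule.lift (act i)
  have hμ (i : ι) : Function.Surjective (μ i) := fun x =>
    ⟨1 ⊗ₜ x, (AlgebraTensorModule.lift_tmul (act i) 1 x).trans (one_smul A x)⟩
  choose s hs using fun i =>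
    LinearMap.exists_rightInverse_of_surjective (μ i) (LinearMap.range_eq_top.2 (hμ i))
  have : Module.Projective A (∀ i, A ⊗[K] P i) :=
    Module.Projective.of_equiv' (LinearEquiv.ofBijective _ (tensorPiHom_bijective K A P))
  refine Module.Projective.of_split (M := ∀ i, A ⊗[K] P i)
    (LinearMap.pi fun i => s i ∘ₗ LinearMap.proj i)
    (LinearMap.pi fun i => μ i ∘ₗ LinearMap.proj i) ?_
  ext x i
  exact LinearMap.congr_fun (hs i) (x i)

/-- The kernel of a product of linear maps is the product of the kernels. -/
def LinearMap.kerPiMapEquiv {R ι : Type*} [Ring R] {M N : ι → Type*} [∀ i, AddCommGroup (M i)]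
    [∀ i, Module R (M i)] [∀ i, AddCommGroup (N i)] [∀ i, Module R (N i)]
    (f : ∀ i, M i →ₗ[R] N i) :
    (∀ i, LinearMap.ker (f i)) ≃ₗ[R]
      LinearMap.ker (LinearMap.pi fun i => f i ∘ₗ LinearMap.proj i) where
  toFun x := ⟨fun i => x i, by ext i; exact (x i).2⟩
  invFun x i := ⟨x.1 i, congrFun x.2 i⟩
  map_add' _ _ := rfl
  map_smul' _ _ := rfl
  left_inv _ := rfl
  right_inv _ := rfl

/-- Over a finite-dimensional algebra `Λ`, any direct product of a family of
left `Λ`-modules each of projective dimension at most `1` again has projective dimension at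
most `1`. -/
theorem prod_hasProjDimLE_one
    (K : Type u) (Λ : Type u) [Field K] [Ring Λ] [Algebra K Λ] [FiniteDimensional K Λ]
    (ι : Type u) (G : ι → ModuleCat.{u} Λ)
    (h : ∀ i, HasProjDimLE Λ 1 (G i)) :
    HasProjDimLE Λ 1 (ModuleCat.of Λ (∀ i, G i)) := by
  choose P g hP hg hker using h
  refine ⟨ModuleCat.of Λ (∀ i, P i), LinearMap.pi fun i => g i ∘ₗ LinearMap.proj i,
    projective_pi_of_finiteDimensional K Λ _ hP, fun y => ?_, ?_⟩
  · choose x hx using fun i => hg i (y i)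
    exact ⟨x, funext hx⟩
  · have := projective_pi_of_finiteDimensional K Λ (fun i => LinearMap.ker (g i)) hker
    exact Module.Projective.of_equiv' (LinearMap.kerPiMapEquiv g)
end

section
/- Let K be a field and Λ a finite-dimensional associative unital K-algebra. Then every left Λ-module of projective dimension at most 1 (not necessarily finitely generated) is a direct limit of a directed system of finitely generated left Λ-modules of finite projective dimension. -/
universe u

/-- A complement of a projective module in a free module. -/
theorem Module.Projective.exists_prod_free {R P : Type u} [Ring R] [AddCommGroup P]
    [Module R P] [Module.Projective R P] :
    ∃ (C : Type u) (_ : AddCommGroup C) (_ : Module R C), Module.Free R (P × C) := by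
  let s : (P →₀ R) →ₗ[R] P := Finsupp.linearCombination R id
  obtain ⟨i, his⟩ := Module.projective_def'.1 ‹Module.Projective R P›
  have hsi (x : P) : s (i x) = x := LinearMap.congr_fun his x
  refine ⟨LinearMap.ker s, inferInstance, inferInstance, Module.Free.of_equiv (M := P →₀ R)
    (LinearEquiv.ofBijective
      (s.prod ((LinearMap.id - i ∘ₗ s).codRestrict (LinearMap.ker s) fun x => by simp [hsi]))
      ⟨?_, ?_⟩)⟩
  · rw [injective_iff_map_eq_zero]
    intro x hx
    have h₁ : s x = 0 := congrArg Prod.fst hx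
    have h₂ : x - i (s x) = 0 := congrArg (fun y : P × LinearMap.ker s => (y.2 : P →₀ R)) hx
    simpa [h₁] using h₂
  · rintro ⟨p, k, hk⟩
    have hk' : s k = 0 := hk
    exact ⟨i p + k, by ext <;> simp [hsi, hk']⟩

/-- Finitely supported functions into a product are pairs of finitely supported functions. -/
noncomputable def Finsupp.prodLEquiv (R α M N : Type*) [Ring R] [AddCommGroup M] [Module R M]
    [AddCommGroup N] [Module R N] : (α →₀ M × N) ≃ₗ[R] (α →₀ M) × (α →₀ N) where
  __ := (Finsupp.mapRange.linearMap (LinearMap.fst R M N)).prod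
    (Finsupp.mapRange.linearMap (LinearMap.snd R M N))
  invFun x := Finsupp.mapRange.linearMap (LinearMap.inl R M N) x.1 +
    Finsupp.mapRange.linearMap (LinearMap.inr R M N) x.2
  left_inv x := by ext <;> simp
  right_inv x := by ext <;> simp

/-- The Eilenberg swindle: a projective module becomes free after adding a suitable free module. -/
theorem Module.Projective.exists_free_prod_free {R P : Type u} [Ring R] [AddCommGroup P]
    [Module R P] [Module.Projective R P] :
    ∃ (F : Type u) (_ : AddCommGroup F) (_ : Module R F),
      Module.Free R F ∧ Module.Free R (P × F) := by
  obtain ⟨C, _, _, _⟩ := Module.Projective.exists_prod_free (R := R) (P := P)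
  refine ⟨ℕ →₀ P × C, inferInstance, inferInstance, inferInstance, ?_⟩
  have absorb : (ℕ →₀ P) ≃ₗ[R] P × (ℕ →₀ P) :=
    Finsupp.domLCongr (Equiv.natSumPUnitEquivNat.{0}.symm.trans (Equiv.sumComm _ _)) ≪≫ₗ
      Finsupp.sumFinsuppLEquivProdFinsupp R ≪≫ₗ
      (Finsupp.uniqueLinearEquiv R P PUnit.unit).prodCongr (LinearEquiv.refl R _)
  exact Module.Free.of_equiv <| Finsupp.prodLEquiv R ℕ P C ≪≫ₗ absorb.prodCongr (LinearEquiv.refl R _) ≪≫ₗ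
    LinearEquiv.prodAssoc R _ _ _ ≪≫ₗ
    (LinearEquiv.refl R P).prodCongr (Finsupp.prodLEquiv R ℕ P C).symm

/-- A module of projective dimension at most one has a resolution of length one by free modules. -/
theorem HasProjDimLE.exists_free_presentation {Λ : Type u} [Ring Λ] {M : ModuleCat.{u} Λ}
    (hM : HasProjDimLE Λ 1 M) :
    ∃ (F : Type u) (_ : AddCommGroup F) (_ : Module Λ F) (g : F →ₗ[Λ] M),
      Module.Free Λ F ∧ Function.Surjective g ∧ Module.Free Λ (LinearMap.ker g) := by
  obtain ⟨P, g, hP, hg, hQ⟩ := hM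
  have hQ : Module.Projective Λ (LinearMap.ker g) := hQ
  obtain ⟨F, _, _, _, _⟩ := Module.Projective.exists_free_prod_free (R := Λ) (P := P)
  obtain ⟨F', _, _, _, _⟩ :=
    Module.Projective.exists_free_prod_free (R := Λ) (P := LinearMap.ker g)
  refine ⟨(P × F) × F', inferInstance, inferInstance,
    g ∘ₗ LinearMap.fst Λ P F ∘ₗ LinearMap.fst Λ (P × F) F', inferInstance, fun m => ?_, ?_⟩
  · obtain ⟨p, rfl⟩ := hg m
    exact ⟨((p, 0), 0), rfl⟩
  · let e : ((LinearMap.ker g × F') × F) ≃ₗ[Λ]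
        LinearMap.ker (g ∘ₗ LinearMap.fst Λ P F ∘ₗ LinearMap.fst Λ (P × F) F') :=
      { toFun := fun x => ⟨((x.1.1, x.2), x.1.2), by simp⟩
        invFun := fun x => ((⟨x.1.1.1, x.2⟩, x.1.2), x.1.1.2)
        map_add' := fun _ _ => rfl
        map_smul' := fun _ _ => rfl
        left_inv := fun _ => rfl
        right_inv := fun _ => rfl }
    exact Module.Free.of_equiv e

/-- The cokernel of an injective map between free modules is a direct limit of cokernels of
injective maps between finitely generated free modules. -/
theorem isDirectLimitOfFGFinProjDim_of_free_presentation {Λ : Type u} [Ring Λ]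
    {M : ModuleCat.{u} Λ} {F : Type u} [AddCommGroup F] [Module Λ F] (g : F →ₗ[Λ] M)
    [Module.Free Λ F] (hg : Function.Surjective g) [Module.Free Λ (LinearMap.ker g)] :
    IsDirectLimitOfFGFinProjDim Λ M := by
  classical
  let b := Module.Free.chooseBasis Λ F
  let c := Module.Free.chooseBasis Λ (LinearMap.ker g)
  let I := Module.Free.ChooseBasisIndex Λ F
  let J := Module.Free.ChooseBasisIndex Λ (LinearMap.ker g)
  let c' : J → F := fun j => c j
  have hc' : LinearIndependent Λ c' :=
    c.linearIndependent.map' (LinearMap.ker g).subtype (Submodule.ker_subtype _)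
  let A (T : Finset I) : Submodule Λ F := Submodule.span Λ (b '' T)
  let B (S : Finset J) : Submodule Λ F := Submodule.span Λ (c' '' S)
  have hA : Monotone A := fun T T' h => Submodule.span_mono (Set.image_mono h)
  have hB : Monotone B := fun S S' h => Submodule.span_mono (Set.image_mono h)
  have hBker (S) : B S ≤ LinearMap.ker g :=
    Submodule.span_le.2 (by rintro _ ⟨j, -, rfl⟩; exact (c j).2)
  have memA (x : F) : x ∈ A (b.repr x).support := b.mem_span_repr_support x
  have memB (x : F) (hx : x ∈ LinearMap.ker g) : x ∈ B (c.repr ⟨x, hx⟩).support := by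
    have h := Submodule.mem_map_of_mem (f := (LinearMap.ker g).subtype)
      (c.mem_span_repr_support ⟨x, hx⟩)
    rwa [Submodule.map_span, ← Set.image_comp] at h
  have cover (S : Finset J) : ∃ T, B S ≤ A T :=
    ⟨S.biUnion fun j => (b.repr (c' j)).support, Submodule.span_le.2 (by
      rintro _ ⟨j, hj, rfl⟩
      exact hA (Finset.subset_biUnion_of_mem (fun j => (b.repr (c' j)).support) hj) (memA _))⟩
  let ι := {p : Finset J × Finset I // B p.1 ≤ A p.2}
  have hdir : IsDirected ι (· ≤ ·) := ⟨fun p q =>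
    let ⟨T, hT⟩ := cover (p.1.1 ∪ q.1.1)
    ⟨⟨(p.1.1 ∪ q.1.1, (p.1.2 ∪ q.1.2) ∪ T), hT.trans (hA Finset.subset_union_right)⟩,
      ⟨Finset.subset_union_left, Finset.subset_union_left.trans Finset.subset_union_left⟩,
      ⟨Finset.subset_union_right, Finset.subset_union_right.trans Finset.subset_union_left⟩⟩⟩
  let N (p : ι) : Submodule Λ (A p.1.2) := (B p.1.1).comap (A p.1.2).subtype
  let G (p : ι) : ModuleCat.{u} Λ := ModuleCat.of Λ (A p.1.2 ⧸ N p)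
  let f (p q : ι) (h : p ≤ q) : G p →ₗ[Λ] G q :=
    Submodule.mapQ (N p) (N q) (Submodule.inclusion (hA h.2)) fun _ hx => hB h.1 hx
  have hsys : DirectedSystem (fun p => G p) (fun p q h => f p q h) :=
    { map_self := fun p x => by
        obtain ⟨x, rfl⟩ := Submodule.mkQ_surjective _ x
        rfl
      map_map := fun p q r _ _ x => by
        obtain ⟨x, rfl⟩ := Submodule.mkQ_surjective _ x
        rfl }
  let φ (p : ι) : G p →ₗ[Λ] M :=
    (N p).liftQ (g ∘ₗ (A p.1.2).subtype) fun _ hx => hBker _ hx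
  have hφ (p q h x) : φ q (f p q h x) = φ p x := by
    obtain ⟨x, rfl⟩ := Submodule.mkQ_surjective _ x
    rfl
  have hne : Nonempty ι := let ⟨T, hT⟩ := cover ∅; ⟨⟨(∅, T), hT⟩⟩
  refine ⟨ι, inferInstance, inferInstance, hne, hdir, G, f, hsys, fun p => ⟨?_, 1, ?_⟩,
    ⟨LinearEquiv.ofBijective (Module.DirectLimit.lift Λ ι (fun p => G p) f φ hφ) ⟨?_, ?_⟩⟩⟩
  · have : Module.Finite Λ (A p.1.2) :=
      Module.Finite.span_of_finite Λ (p.1.2.finite_toSet.image b)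
    exact inferInstanceAs (Module.Finite Λ (A p.1.2 ⧸ N p))
  · refine ⟨ModuleCat.of Λ (A p.1.2), (N p).mkQ, ?_, Submodule.mkQ_surjective _, ?_⟩
    · have h := Module.Basis.span
        (b.linearIndependent.comp ((↑) : p.1.2 → I) Subtype.val_injective)
      rw [Set.range_comp, Subtype.range_coe_subtype] at h
      exact Module.Projective.of_basis h
    · change Module.Projective Λ (LinearMap.ker (N p).mkQ)
      rw [Submodule.ker_mkQ]
      have h := Module.Basis.span (hc'.comp ((↑) : p.1.1 → J) Subtype.val_injective)
      rw [Set.range_comp, Subtype.range_coe_subtype] at h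
      exact Module.Projective.of_basis (h.map (Submodule.comapSubtypeEquivOfLe p.2).symm)
  · rw [injective_iff_map_eq_zero]
    intro z hz
    obtain ⟨p, x, rfl⟩ := Module.DirectLimit.exists_of z
    rw [Module.DirectLimit.lift_of] at hz
    obtain ⟨x, rfl⟩ := Submodule.mkQ_surjective _ x
    have hx : (x : F) ∈ LinearMap.ker g := hz
    obtain ⟨T, hT⟩ := cover (p.1.1 ∪ (c.repr ⟨x, hx⟩).support)
    let q : ι := ⟨(p.1.1 ∪ (c.repr ⟨x, hx⟩).support, p.1.2 ∪ T),
      hT.trans (hA Finset.subset_union_right)⟩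
    have hpq : p ≤ q := ⟨Finset.subset_union_left, Finset.subset_union_left⟩
    rw [← Module.DirectLimit.of_f (hij := hpq)]
    have h0 : f p q hpq ((N p).mkQ x) = 0 :=
      (Submodule.Quotient.mk_eq_zero (N q)).2 (hB Finset.subset_union_right (memB x hx))
    rw [h0, map_zero]
  · intro m
    obtain ⟨x, rfl⟩ := hg m
    obtain ⟨T, hT⟩ := cover ∅
    let q : ι := ⟨(∅, (b.repr x).support ∪ T), hT.trans (hA Finset.subset_union_right)⟩
    refine ⟨Module.DirectLimit.of Λ ι (fun p => G p) f q
      ((N q).mkQ ⟨x, hA Finset.subset_union_left (memA x)⟩), ?_⟩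
    rw [Module.DirectLimit.lift_of]
    rfl

/-- Over a finite-dimensional algebra `Λ`, every left `Λ`-module of
projective dimension at most `1` (not necessarily finitely generated) is a direct limit of a
directed system of finitely generated left `Λ`-modules of finite projective dimension. -/
theorem projDimLE_one_isDirectLimit
    (K : Type u) (Λ : Type u) [Field K] [Ring Λ] [Algebra K Λ] [FiniteDimensional K Λ] :
    ∀ M : ModuleCat.{u} Λ, HasProjDimLE Λ 1 M → IsDirectLimitOfFGFinProjDim Λ M := by
  intro M hM
  obtain ⟨F, _, _, g, _, hg, _⟩ := hM.exists_free_presentation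
  exact isDirectLimitOfFGFinProjDim_of_free_presentation g hg
end
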